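/- arXiv:2403.16480 — 6 statements merged into one kernel-verified Lean document; each statement's English description precedes it below -/
import Mathlib

section
/- Every quaternion matrix A ∈ ℍ^{n₁×n₂} admits a quaternion singular value decomposition: there exist unitary quaternion matrices U ∈ ℍ^{n₁×n₁} and V ∈ ℍ^{n₂×n₂} and an n₁×n₂ matrix D whose entries are real and nonnegative, which vanishes off the main diagonal, and whose diagonal entries are nonincreasing, such that A = U D V*. -/
noncomputable section
open Matrix Kronecker Filter Topology

namespace QTpaper

/-- The quaternion unit `i`. -/
def qi : Quaternion ℝ := ⟨0, 1, 0, 0⟩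
/-- The quaternion unit `j`. -/
def qj : Quaternion ℝ := ⟨0, 0, 1, 0⟩
/-- The quaternion unit `k`. -/
def qk : Quaternion ℝ := ⟨0, 0, 0, 1⟩

/-- A unit pure quaternion: zero real part and norm one. -/
def UnitPure (μ : Quaternion ℝ) : Prop := μ.re = 0 ∧ ‖μ‖ = 1

/-- Third-order quaternion tensors. -/
abbrev QTensor (a b c : ℕ) := Fin a → Fin b → Fin c → Quaternion ℝ

/-- `l`-th frontal slice of a third-order tensor. -/
def fslice {a b c : ℕ} (A : QTensor a b c) (l : Fin c) :
    Matrix (Fin a) (Fin b) (Quaternion ℝ) := fun p q => A p q l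

/-- Frobenius norm of a quaternion matrix. -/
def frobM {m n : ℕ} (A : Matrix (Fin m) (Fin n) (Quaternion ℝ)) : ℝ :=
  Real.sqrt (∑ p, ∑ q, ‖A p q‖ ^ 2)

/-- Frobenius norm of a third-order quaternion tensor. -/
def frobT {a b c : ℕ} (A : QTensor a b c) : ℝ :=
  Real.sqrt (∑ p, ∑ q, ∑ l, ‖A p q l‖ ^ 2)

/-- The normalized QDFT matrix `F_{μ,n}` with entries
`(1/√n)·ω^{(p-1)(q-1)}`, `ω^m = cos(2πm/n) − μ·sin(2πm/n)`. -/
def Fq (μ : Quaternion ℝ) (n : ℕ) : Matrix (Fin n) (Fin n) (Quaternion ℝ) :=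
  fun p q =>
    ((1 / Real.sqrt n : ℝ) : Quaternion ℝ) *
      (((Real.cos (2 * Real.pi * (p.1 * q.1) / n) : ℝ) : Quaternion ℝ)
        - ((Real.sin (2 * Real.pi * (p.1 * q.1) / n) : ℝ) : Quaternion ℝ) * μ)

/-- The permutation matrix `P_n` (1-based: `P₁₁ = 1`, `P_{pq} = 1` for `p+q = n+2`). -/
def Pmat (n : ℕ) : Matrix (Fin n) (Fin n) ℝ :=
  fun p q => if (p.1 = 0 ∧ q.1 = 0) ∨ (p.1 + q.1 = n) then 1 else 0

/-- Block circulant matrix of a third-order tensor. -/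
def circ {a b c : ℕ} (A : QTensor a b c) :
    Matrix (Fin c × Fin a) (Fin c × Fin b) (Quaternion ℝ) :=
  fun pi qj => A pi.2 qj.2 (pi.1 - qj.1)

/-- `unfold` stacks the frontal slices vertically. -/
def unfold3 {a b c : ℕ} (A : QTensor a b c) :
    Matrix (Fin c × Fin a) (Fin b) (Quaternion ℝ) :=
  fun pi q => A pi.2 q pi.1

/-- `fold` is the inverse of `unfold`. -/
def fold3 {a b c : ℕ} (M : Matrix (Fin c × Fin a) (Fin b) (Quaternion ℝ)) :
    QTensor a b c := fun p q l => M (l, p) q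

/-- Block diagonal matrix whose `l`-th diagonal block is the `l`-th frontal slice. -/
def diagT {a b c : ℕ} (A : QTensor a b c) :
    Matrix (Fin c × Fin a) (Fin c × Fin b) (Quaternion ℝ) :=
  fun pi qj => if pi.1 = qj.1 then A pi.2 qj.2 pi.1 else 0

/-- The QDFT along mode 3: `fft(A)(p,q,:) = √n₃ · F_{μ,n₃} · A(p,q,:)`. -/
def fftT {a b c : ℕ} (μ : Quaternion ℝ) (A : QTensor a b c) : QTensor a b c :=
  fun p q l => ((Real.sqrt c : ℝ) : Quaternion ℝ) * ∑ m, Fq μ c l m * A p q m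

/-- Real-part component tensor. -/
def compE {a b c : ℕ} (A : QTensor a b c) : QTensor a b c :=
  fun p q l => (((A p q l).re : ℝ) : Quaternion ℝ)
/-- `i`-component tensor. -/
def compI {a b c : ℕ} (A : QTensor a b c) : QTensor a b c :=
  fun p q l => (((A p q l).imI : ℝ) : Quaternion ℝ)
/-- `j`-component tensor. -/
def compJ {a b c : ℕ} (A : QTensor a b c) : QTensor a b c :=
  fun p q l => (((A p q l).imJ : ℝ) : Quaternion ℝ)
/-- `k`-component tensor. -/
def compK {a b c : ℕ} (A : QTensor a b c) : QTensor a b c :=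
  fun p q l => (((A p q l).imK : ℝ) : Quaternion ℝ)

/-- For `μ = a·i + b·j + c·k`, `μ_i = a·i − b·j − c·k`. -/
def mui (μ : Quaternion ℝ) : Quaternion ℝ := ⟨0, μ.imI, -μ.imJ, -μ.imK⟩
/-- For `μ = a·i + b·j + c·k`, `μ_j = −a·i + b·j − c·k`. -/
def muj (μ : Quaternion ℝ) : Quaternion ℝ := ⟨0, -μ.imI, μ.imJ, -μ.imK⟩
/-- For `μ = a·i + b·j + c·k`, `μ_k = −a·i − b·j + c·k`. -/
def muk (μ : Quaternion ℝ) : Quaternion ℝ := ⟨0, -μ.imI, -μ.imJ, μ.imK⟩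

/-- `T` matrix `F_{ν,n}^* · F_{μ,n}`. -/
def Tm (ν μ : Quaternion ℝ) (n : ℕ) : Matrix (Fin n) (Fin n) (Quaternion ℝ) :=
  (Fq ν n)ᴴ * Fq μ n

/-- The gQt-product of third-order quaternion tensors. -/
def gQt {n₁ r n₂ n₃ : ℕ} (μ : Quaternion ℝ) (A : QTensor n₁ r n₃)
    (B : QTensor r n₂ n₃) : QTensor n₁ n₂ n₃ :=
  fold3 ((circ (compE A)
      + qi • (circ (compI A) * (Tm (mui μ) μ n₃ ⊗ₖ (1 : Matrix (Fin r) (Fin r) (Quaternion ℝ))))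
      + qj • (circ (compJ A) * (Tm (muj μ) μ n₃ ⊗ₖ (1 : Matrix (Fin r) (Fin r) (Quaternion ℝ))))
      + qk • (circ (compK A) * (Tm (muk μ) μ n₃ ⊗ₖ (1 : Matrix (Fin r) (Fin r) (Quaternion ℝ)))))
    * unfold3 B)

/-- The index reversal `1 ↦ 1`, `l ↦ n₃ + 2 − l` (1-based), used in the tensor transpose. -/
def revIdx {c : ℕ} (l : Fin c) : Fin c :=
  if h : l.1 = 0 then l else ⟨c - l.1, by have := l.2; omega⟩

/-- Transpose of a (componentwise real) tensor: transpose each frontal slice and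
reverse the order of the transposed slices `2` through `n₃`. -/
def transT {a b c : ℕ} (A : QTensor a b c) : QTensor b a c :=
  fun q p l => A p q (revIdx l)

/-- Right multiplication of a matrix by a quaternion scalar. -/
def rmulM {m n : Type*} (M : Matrix m n (Quaternion ℝ)) (x : Quaternion ℝ) :
    Matrix m n (Quaternion ℝ) := fun p q => M p q * x

/-- Conjugate transpose of a third-order quaternion tensor. -/
def conjT {n₁ n₂ n₃ : ℕ} (μ : Quaternion ℝ) (A : QTensor n₁ n₂ n₃) : QTensor n₂ n₁ n₃ :=
  fold3 (unfold3 (transT (compE A))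
    - rmulM (((Tm (mui μ) μ n₃)ᴴ ⊗ₖ (1 : Matrix (Fin n₂) (Fin n₂) (Quaternion ℝ)))
        * unfold3 (transT (compI A))) qi
    - rmulM (((Tm (muj μ) μ n₃)ᴴ ⊗ₖ (1 : Matrix (Fin n₂) (Fin n₂) (Quaternion ℝ)))
        * unfold3 (transT (compJ A))) qj
    - rmulM (((Tm (muk μ) μ n₃)ᴴ ⊗ₖ (1 : Matrix (Fin n₂) (Fin n₂) (Quaternion ℝ)))
        * unfold3 (transT (compK A))) qk)

/-- The identity tensor: first frontal slice is the identity, the others vanish. -/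
def idT (n l : ℕ) : QTensor n n l :=
  fun p q m => if m.1 = 0 ∧ p = q then 1 else 0

/-- Unitary tensor with respect to the gQt-product. -/
def unitaryT {n n₃ : ℕ} (μ : Quaternion ℝ) (U : QTensor n n n₃) : Prop :=
  gQt μ (conjT μ U) U = idT n n₃ ∧ gQt μ U (conjT μ U) = idT n n₃

/-- f-diagonal tensor: each frontal slice is a diagonal matrix. -/
def fDiag {a b c : ℕ} (S : QTensor a b c) : Prop :=
  ∀ p q l, p.1 ≠ q.1 → S p q l = 0

theorem quaternion_re_sum {ι : Type*} (s : Finset ι) (f : ι → Quaternion ℝ) :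
    (∑ i ∈ s, f i).re = ∑ i ∈ s, (f i).re :=
  map_sum (QuaternionAlgebra.reₗ (-1 : ℝ) 0 (-1)) f s

theorem re_trace_mul {m n : Type*} [Fintype m] [Fintype n]
    (A : Matrix m n (Quaternion ℝ)) (B : Matrix n m (Quaternion ℝ)) :
    (A * B).trace.re = ∑ i, ∑ j, (A i j * B j i).re := by
  simp only [Matrix.trace, Matrix.diag, Matrix.mul_apply, quaternion_re_sum]

/-- The real part of the trace is cyclic, although the trace itself is not. -/
theorem re_trace_mul_comm {m n : Type*} [Fintype m] [Fintype n]
    (A : Matrix m n (Quaternion ℝ)) (B : Matrix n m (Quaternion ℝ)) :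
    (A * B).trace.re = (B * A).trace.re := by
  rw [re_trace_mul, re_trace_mul, Finset.sum_comm]
  refine Finset.sum_congr rfl fun i _ => Finset.sum_congr rfl fun j _ => ?_
  simp only [Quaternion.re_mul]
  ring

theorem re_trace_conjTranspose {n : Type*} [Fintype n] (A : Matrix n n (Quaternion ℝ)) :
    Aᴴ.trace.re = A.trace.re := by
  rw [Matrix.trace_conjTranspose, Quaternion.re_star]

theorem eq_zero_of_re_trace_conjTranspose_mul_self {m n : Type*} [Fintype m] [Fintype n]
    {A : Matrix m n (Quaternion ℝ)} (h : (Aᴴ * A).trace.re = 0) : A = 0 := by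
  have hterm (i : n) (j : m) : (Aᴴ i j * A j i).re = Quaternion.normSq (A j i) := by
    rw [Matrix.conjTranspose_apply, Quaternion.star_mul_self, Quaternion.re_coe]
  simp only [re_trace_mul, hterm] at h
  ext1 i j
  have h₁ := (Finset.sum_eq_zero_iff_of_nonneg
    (fun j _ => Finset.sum_nonneg fun i _ => Quaternion.normSq_nonneg)).1 h j (Finset.mem_univ j)
  exact Quaternion.normSq_eq_zero.1 ((Finset.sum_eq_zero_iff_of_nonneg
    (fun i _ => Quaternion.normSq_nonneg)).1 h₁ i (Finset.mem_univ i))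

theorem exp_smul_mem_unitary {n : Type*} [Fintype n] [DecidableEq n]
    {X : Matrix n n (Quaternion ℝ)} (hX : Xᴴ = -X) (t : ℝ) :
    NormedSpace.exp (t • X) ∈ unitary (Matrix n n (Quaternion ℝ)) := by
  let _ : NormedAlgebra ℚ (Quaternion ℝ) := NormedAlgebra.restrictScalars ℚ ℝ _
  have hneg : (t • X)ᴴ = -(t • X) := by
    ext1 i j
    rw [Matrix.conjTranspose_apply, Matrix.smul_apply, Quaternion.star_smul,
      ← Matrix.conjTranspose_apply, hX, Matrix.neg_apply, Matrix.neg_apply, Matrix.smul_apply,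
      smul_neg]
  rw [Unitary.mem_iff, star_eq_conjTranspose, ← Matrix.exp_conjTranspose, hneg,
    ← Matrix.exp_add_of_commute _ _ (Commute.refl (t • X)).neg_left,
    ← Matrix.exp_add_of_commute _ _ (Commute.refl (t • X)).neg_right, neg_add_cancel, add_neg_cancel,
    NormedSpace.exp_zero]
  exact ⟨rfl, rfl⟩

theorem hasDerivAt_re_trace_exp_smul_mul {n : Type*} [Fintype n] [DecidableEq n]
    (X N : Matrix n n (Quaternion ℝ)) :
    HasDerivAt (fun t : ℝ => (NormedSpace.exp (t • X) * N).trace.re) (X * N).trace.re 0 := by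
  let _ : NormedRing (Matrix n n (Quaternion ℝ)) := Matrix.linftyOpNormedRing
  let _ : NormedAlgebra ℝ (Matrix n n (Quaternion ℝ)) := Matrix.linftyOpNormedAlgebra
  have h := hasDerivAt_exp_smul_const (𝕂 := ℝ) X (0 : ℝ)
  rw [zero_smul, NormedSpace.exp_zero, one_mul] at h
  let T : Matrix n n (Quaternion ℝ) →ₗ[ℝ] ℝ := (QuaternionAlgebra.reₗ (-1 : ℝ) 0 (-1)) ∘ₗ
    Matrix.traceLinearMap n ℝ (Quaternion ℝ) ∘ₗ LinearMap.mulRight ℝ N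
  exact (LinearMap.toContinuousLinearMap T).hasFDerivAt.comp_hasDerivAt _ h

/-- If `Re tr (W N)` is maximized over unitary `W` at `W = 1`, then `N` is Hermitian. -/
theorem conjTranspose_eq_of_re_trace_unitary_mul_le {n : Type*} [Fintype n] [DecidableEq n]
    {N : Matrix n n (Quaternion ℝ)}
    (h : ∀ W ∈ unitary (Matrix n n (Quaternion ℝ)), (W * N).trace.re ≤ N.trace.re) :
    Nᴴ = N := by
  have hX : (N - Nᴴ)ᴴ = -(N - Nᴴ) := by
    rw [Matrix.conjTranspose_sub, Matrix.conjTranspose_conjTranspose, neg_sub]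
  have hmax : IsLocalMax
      (fun t : ℝ => (NormedSpace.exp (t • (N - Nᴴ)) * N).trace.re) 0 :=
    Filter.Eventually.of_forall fun t => by
      simpa only [zero_smul, NormedSpace.exp_zero, one_mul] using h _ (exp_smul_mem_unitary hX t)
  have h₀ : ((N - Nᴴ) * N).trace.re = 0 :=
    hmax.hasDerivAt_eq_zero (hasDerivAt_re_trace_exp_smul_mul _ _)
  have h₁ : ((N - Nᴴ) * Nᴴ).trace.re = 0 := by
    rw [← re_trace_conjTranspose, Matrix.conjTranspose_mul, hX, re_trace_mul_comm,
      Matrix.conjTranspose_conjTranspose, Matrix.neg_mul, Matrix.trace_neg, Quaternion.re_neg,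
      h₀, neg_zero]
  have h₂ : ((N - Nᴴ)ᴴ * (N - Nᴴ)).trace.re = 0 := by
    rw [hX, Matrix.neg_mul, Matrix.mul_sub, Matrix.trace_neg, Matrix.trace_sub,
      Quaternion.re_neg, Quaternion.re_sub, h₀, h₁, sub_zero, neg_zero]
  exact (sub_eq_zero.1 (eq_zero_of_re_trace_conjTranspose_mul_self h₂)).symm

theorem norm_apply_le_one_of_mem_unitary {n : Type*} [Fintype n] [DecidableEq n]
    {U : Matrix n n (Quaternion ℝ)} (hU : U ∈ unitary (Matrix n n (Quaternion ℝ))) (i j : n) :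
    ‖U i j‖ ≤ 1 := by
  have h : (Uᴴ * U) j j = 1 := by
    rw [← star_eq_conjTranspose, Unitary.star_mul_self_of_mem hU, Matrix.one_apply_eq]
  have hsum : ∑ k, ‖U k j‖ ^ 2 = 1 := by
    have h₁ := congrArg (fun x : Quaternion ℝ => x.re) h
    simp only [Matrix.mul_apply, quaternion_re_sum, Matrix.conjTranspose_apply,
      Quaternion.star_mul_self, Quaternion.re_coe, Quaternion.normSq_eq_norm_mul_self,
      Quaternion.re_one] at h₁
    simpa only [sq] using h₁
  have hle : ‖U i j‖ ^ 2 ≤ 1 :=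
    hsum ▸ Finset.single_le_sum (f := fun k => ‖U k j‖ ^ 2)
      (fun k _ => sq_nonneg _) (Finset.mem_univ i)
  exact (sq_le_one_iff₀ (norm_nonneg _)).1 hle

theorem isCompact_unitary_matrix (n : Type*) [Fintype n] [DecidableEq n] :
    IsCompact (unitary (Matrix n n (Quaternion ℝ)) : Set (Matrix n n (Quaternion ℝ))) := by
  have hstar : Continuous fun U : Matrix n n (Quaternion ℝ) => Uᴴ :=
    continuous_id.matrix_conjTranspose
  have hclosed :
      IsClosed (unitary (Matrix n n (Quaternion ℝ)) : Set (Matrix n n (Quaternion ℝ))) :=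
    (isClosed_eq (hstar.matrix_mul continuous_id) continuous_const).inter
      (isClosed_eq (continuous_id.matrix_mul hstar) continuous_const)
  have : ProperSpace (Quaternion ℝ) := FiniteDimensional.proper_real _
  have hball : IsCompact (Set.univ.pi fun _ : n => Set.univ.pi fun _ : n =>
      Metric.closedBall (0 : Quaternion ℝ) 1) :=
    isCompact_univ_pi fun _ => isCompact_univ_pi fun _ => isCompact_closedBall _ _
  exact hball.of_isClosed_subset hclosed fun U hU i _ j _ =>
    mem_closedBall_zero_iff.2 (norm_apply_le_one_of_mem_unitary hU i j)

theorem one_submatrix_mem_unitary {n : Type*} [Fintype n] [DecidableEq n] (σ : Equiv.Perm n) :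
    (1 : Matrix n n (Quaternion ℝ)).submatrix σ id ∈ unitary (Matrix n n (Quaternion ℝ)) := by
  rw [Unitary.mem_iff, star_eq_conjTranspose, Matrix.conjTranspose_submatrix,
    Matrix.conjTranspose_one]
  constructor
  · rw [Matrix.submatrix_mul_equiv, Matrix.one_mul, Matrix.submatrix_id_id]
  · rw [← Matrix.submatrix_mul _ _ _ _ _ Function.bijective_id, Matrix.one_mul,
      Matrix.submatrix_one_equiv]

theorem one_submatrix_mul {m n : Type*} [Fintype m] [DecidableEq m] (σ : m → m)
    (M : Matrix m n (Quaternion ℝ)) :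
    (1 : Matrix m m (Quaternion ℝ)).submatrix σ id * M = M.submatrix σ id := by
  simpa only [Matrix.submatrix_id_id, Matrix.one_mul] using
    (Matrix.submatrix_mul 1 M σ id id Function.bijective_id).symm

theorem mul_one_submatrix {m n : Type*} [Fintype n] [DecidableEq n] (τ : Equiv.Perm n)
    (M : Matrix m n (Quaternion ℝ)) :
    M * (1 : Matrix n n (Quaternion ℝ)).submatrix τ id = M.submatrix id τ.symm := by
  simpa using Matrix.mul_submatrix_one τ id M

theorem diagonal_sign_mem_unitary {n : Type*} [Fintype n] [DecidableEq n] (i : n) :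
    Matrix.diagonal (fun j => if j = i then (-1 : Quaternion ℝ) else 1) ∈
      unitary (Matrix n n (Quaternion ℝ)) := by
  have h : star (Matrix.diagonal fun j => if j = i then (-1 : Quaternion ℝ) else 1) =
      Matrix.diagonal fun j => if j = i then (-1 : Quaternion ℝ) else 1 := by
    rw [star_eq_conjTranspose, Matrix.diagonal_conjTranspose]
    congr 1
    ext1 j
    simp [apply_ite star]
  have h₂ : (Matrix.diagonal fun j => if j = i then (-1 : Quaternion ℝ) else 1) *
      (Matrix.diagonal fun j => if j = i then (-1 : Quaternion ℝ) else 1) = 1 := by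
    rw [Matrix.diagonal_mul_diagonal, ← Matrix.diagonal_one]
    congr 1
    ext1 j
    split_ifs <;> simp
  rw [Unitary.mem_iff, h]
  exact ⟨h₂, h₂⟩

/-- If `Re tr (W N)` is maximized over unitary `W` at `W = 1`, then the diagonal of `N` has
nonnegative real parts. -/
theorem re_diag_nonneg_of_re_trace_unitary_mul_le {n : Type*} [Fintype n] [DecidableEq n]
    {N : Matrix n n (Quaternion ℝ)}
    (h : ∀ W ∈ unitary (Matrix n n (Quaternion ℝ)), (W * N).trace.re ≤ N.trace.re) (i : n) :
    0 ≤ (N i i).re := by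
  have h₁ := h _ (diagonal_sign_mem_unitary i)
  simp only [Matrix.trace, Matrix.diag, Matrix.diagonal_mul, quaternion_re_sum] at h₁
  rw [← sub_nonneg, ← Finset.sum_sub_distrib, Finset.sum_eq_single i] at h₁
  · simp at h₁
    linarith
  · intro j _ hj
    simp [hj]
  · simp

/-- The rectangular diagonal matrix with diagonal entries `w p`. -/
def weightMatrix {n₁ : ℕ} (w : Fin n₁ → ℝ) (n₂ : ℕ) : Matrix (Fin n₂) (Fin n₁) (Quaternion ℝ) :=
  fun q p => if p.1 = q.1 then (w p : Quaternion ℝ) else 0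

section WeightMatrix

variable {n₁ n₂ : ℕ} (w : Fin n₁ → ℝ) (M : Matrix (Fin n₁) (Fin n₂) (Quaternion ℝ))

theorem mul_weightMatrix_apply (p : Fin n₁) {p' : Fin n₁} {q : Fin n₂} (h : p'.1 = q.1) :
    (M * weightMatrix w n₂) p p' = M p q * w p' := by
  rw [Matrix.mul_apply, Finset.sum_eq_single q]
  · simp [weightMatrix, h]
  · intro q' _ hq'
    have : p'.1 ≠ q'.1 := fun h' => hq' (Fin.ext (h'.symm.trans h))
    simp [weightMatrix, this]
  · simp

theorem mul_weightMatrix_apply_of_le (p : Fin n₁) {p' : Fin n₁} (h : n₂ ≤ p'.1) :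
    (M * weightMatrix w n₂) p p' = 0 := by
  rw [Matrix.mul_apply]
  refine Finset.sum_eq_zero fun q _ => ?_
  have : p'.1 ≠ q.1 := by omega
  simp [weightMatrix, this]

theorem weightMatrix_mul_apply {p : Fin n₁} {q : Fin n₂} (h : p.1 = q.1) (q' : Fin n₂) :
    (weightMatrix w n₂ * M) q q' = w p * M p q' := by
  rw [Matrix.mul_apply, Finset.sum_eq_single p]
  · simp [weightMatrix, h]
  · intro p' _ hp'
    have : p'.1 ≠ q.1 := fun h' => hp' (Fin.ext (h'.trans h.symm))
    simp [weightMatrix, this]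
  · simp

theorem weightMatrix_mul_apply_of_le {q : Fin n₂} (h : n₁ ≤ q.1) (q' : Fin n₂) :
    (weightMatrix w n₂ * M) q q' = 0 := by
  rw [Matrix.mul_apply]
  refine Finset.sum_eq_zero fun p _ => ?_
  have : p.1 ≠ q.1 := by omega
  simp [weightMatrix, this]

variable {w M}

/-- If both products of `M` with a diagonal matrix of distinct positive weights are Hermitian,
then `M` vanishes off the diagonal. -/
theorem apply_eq_zero_of_mul_weightMatrix_hermitian (hpos : ∀ p, 0 < w p)
    (hinj : Function.Injective w)
    (hMC : (M * weightMatrix w n₂)ᴴ = M * weightMatrix w n₂)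
    (hCM : (weightMatrix w n₂ * M)ᴴ = weightMatrix w n₂ * M)
    {p : Fin n₁} {q : Fin n₂} (hpq : p.1 ≠ q.1) : M p q = 0 := by
  have hw (p : Fin n₁) : (w p : Quaternion ℝ) ≠ 0 :=
    fun h => (hpos p).ne' (Quaternion.coe_injective (h.trans Quaternion.coe_zero.symm))
  have hMC' (p p' : Fin n₁) := congrFun (congrFun hMC p) p'
  have hCM' (q q' : Fin n₂) := congrFun (congrFun hCM q) q'
  simp only [Matrix.conjTranspose_apply] at hMC' hCM'
  rcases lt_or_ge q.1 n₁ with hq | hq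
  · have h₁ := hMC' p ⟨q, hq⟩
    rw [mul_weightMatrix_apply w M p (p' := ⟨q, hq⟩) (q := q) rfl] at h₁
    rcases lt_or_ge p.1 n₂ with hp | hp
    · rw [mul_weightMatrix_apply w M _ (p' := p) (q := ⟨p, hp⟩) rfl] at h₁
      have h₂ := hCM' ⟨p, hp⟩ q
      rw [weightMatrix_mul_apply w M (p := p) (q := ⟨p, hp⟩) rfl,
        weightMatrix_mul_apply w M (p := ⟨q, hq⟩) (q := q) rfl] at h₂
      set x := M p q
      set y := M ⟨q, hq⟩ ⟨p, hp⟩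
      set a := w p
      set b := w ⟨q, hq⟩
      have hab : a ≠ b := fun h => hpq (congrArg Fin.val (hinj h))
      rw [star_mul, Quaternion.star_coe] at h₁ h₂
      rw [Quaternion.coe_mul_eq_smul, Quaternion.mul_coe_eq_smul] at h₁ h₂
      have h₃ : (a ^ 2 - b ^ 2) • x = 0 := by
        rw [sub_smul, sq, sq, mul_smul, mul_smul, ← h₁, ← h₂, smul_comm, sub_self]
      refine (smul_eq_zero.1 h₃).resolve_left fun h => hab ?_
      exact (sq_eq_sq₀ (hpos _).le (hpos _).le).1 (sub_eq_zero.1 h)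
    · rw [mul_weightMatrix_apply_of_le w M _ hp, star_zero] at h₁
      exact (mul_eq_zero.1 h₁.symm).resolve_right (hw _)
  · have hp : p.1 < n₂ := by omega
    have h₂ := hCM' ⟨p, hp⟩ q
    rw [weightMatrix_mul_apply w M (p := p) (q := ⟨p, hp⟩) rfl,
      weightMatrix_mul_apply_of_le w M hq, star_zero] at h₂
    exact (mul_eq_zero.1 h₂.symm).resolve_left (hw _)

theorem re_trace_weightMatrix_mul :
    (weightMatrix w n₂ * M).trace.re =
      ∑ x : Fin n₁ × Fin n₂, (if x.1.1 = x.2.1 then w x.1 else 0) * (M x.1 x.2).re := by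
  rw [re_trace_mul, Finset.sum_comm, ← Finset.univ_product_univ, Finset.sum_product]
  refine Finset.sum_congr rfl fun p _ => Finset.sum_congr rfl fun q _ => ?_
  rw [weightMatrix]
  split_ifs
  · rw [Quaternion.coe_mul_eq_smul, Quaternion.re_smul, smul_eq_mul]
  · rw [zero_mul, zero_mul, Quaternion.re_zero]

/-- If exchanging two diagonal entries of `M` does not increase the weighted
trace, then these entries are ordered like the weights. -/
theorem re_apply_le_of_re_trace_swap_le
    {a b : Fin n₁} {a' b' : Fin n₂} (ha : a.1 = a'.1) (hb : b.1 = b'.1) (hab : w b < w a)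
    (h : (weightMatrix w n₂ * M.submatrix (Equiv.swap a b) (Equiv.swap a' b')).trace.re ≤
      (weightMatrix w n₂ * M).trace.re) :
    (M b b').re ≤ (M a a').re := by
  have hne : a ≠ b := fun h => hab.ne (congrArg w h.symm)
  have hne' : a' ≠ b' := fun h => hne (Fin.ext (by rw [ha, hb, h]))
  rw [re_trace_weightMatrix_mul, re_trace_weightMatrix_mul, ← sub_nonneg,
    ← Finset.sum_sub_distrib,
    Fintype.sum_eq_add (a, a') (b, b') (fun h => hne (congrArg Prod.fst h))] at h
  · simp only [ha, hb, if_true, Matrix.submatrix_apply, Equiv.swap_apply_left,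
      Equiv.swap_apply_right] at h
    nlinarith
  · rintro ⟨p, q⟩ ⟨hpa, hpb⟩
    by_cases hpq : p.1 = q.1
    · have hp₁ : p ≠ a := by
        rintro rfl
        exact hpa (Prod.ext rfl (Fin.ext (hpq.symm.trans ha)))
      have hp₂ : p ≠ b := by
        rintro rfl
        exact hpb (Prod.ext rfl (Fin.ext (hpq.symm.trans hb)))
      have hq₁ : q ≠ a' := fun h => hp₁ (Fin.ext (by rw [hpq, h, ha]))
      have hq₂ : q ≠ b' := fun h => hp₂ (Fin.ext (by rw [hpq, h, hb]))
      simp [Equiv.swap_apply_of_ne_of_ne hp₁ hp₂, Equiv.swap_apply_of_ne_of_ne hq₁ hq₂]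
    · simp [hpq]

end WeightMatrix

/-- The unitary pair maximizing the weighted trace of `Uᴴ * A * V` exists by compactness. -/
theorem exists_unitary_forall_re_trace_le {n₁ n₂ : ℕ}
    (C : Matrix (Fin n₂) (Fin n₁) (Quaternion ℝ)) (A : Matrix (Fin n₁) (Fin n₂) (Quaternion ℝ)) :
    ∃ U ∈ unitary (Matrix (Fin n₁) (Fin n₁) (Quaternion ℝ)),
      ∃ V ∈ unitary (Matrix (Fin n₂) (Fin n₂) (Quaternion ℝ)),
        ∀ W ∈ unitary (Matrix (Fin n₁) (Fin n₁) (Quaternion ℝ)),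
          ∀ Z ∈ unitary (Matrix (Fin n₂) (Fin n₂) (Quaternion ℝ)),
            (C * (W * (Uᴴ * A * V) * Z)).trace.re ≤ (C * (Uᴴ * A * V)).trace.re := by
  have hcont : Continuous fun x : Matrix (Fin n₁) (Fin n₁) (Quaternion ℝ) ×
      Matrix (Fin n₂) (Fin n₂) (Quaternion ℝ) => (C * (x.1ᴴ * A * x.2)).trace.re :=
    Quaternion.continuous_re.comp (continuous_const.matrix_mul
      ((continuous_fst.matrix_conjTranspose.matrix_mul continuous_const).matrix_mul
        continuous_snd)).matrix_trace
  obtain ⟨⟨U, V⟩, ⟨hU, hV⟩, hmax⟩ :=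
    ((isCompact_unitary_matrix (Fin n₁)).prod (isCompact_unitary_matrix (Fin n₂))).exists_isMaxOn
      ⟨(1, 1), one_mem _, one_mem _⟩ hcont.continuousOn
  refine ⟨U, hU, V, hV, fun W hW Z hZ => ?_⟩
  have h := hmax (show (U * Wᴴ, V * Z) ∈ _ from
    ⟨mul_mem hU (Unitary.star_mem hW), mul_mem hV hZ⟩)
  simpa only [Set.mem_ofPred_eq, Matrix.conjTranspose_mul, Matrix.conjTranspose_conjTranspose,
    Matrix.mul_assoc] using h

/-- existence of the quaternion SVD. -/
theorem quaternion_matrix_svd {n₁ n₂ : ℕ} (A : Matrix (Fin n₁) (Fin n₂) (Quaternion ℝ)) :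
    ∃ (U : Matrix (Fin n₁) (Fin n₁) (Quaternion ℝ))
      (V : Matrix (Fin n₂) (Fin n₂) (Quaternion ℝ))
      (D : Matrix (Fin n₁) (Fin n₂) ℝ),
      U * Uᴴ = 1 ∧ Uᴴ * U = 1 ∧ V * Vᴴ = 1 ∧ Vᴴ * V = 1 ∧
      (∀ p q, 0 ≤ D p q) ∧
      (∀ p q, p.1 ≠ q.1 → D p q = 0) ∧
      (∀ (p p' : Fin n₁) (q q' : Fin n₂),
          p.1 = q.1 → p'.1 = q'.1 → p.1 ≤ p'.1 → D p' q' ≤ D p q) ∧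
      A = U * D.map (fun x => (x : Quaternion ℝ)) * Vᴴ := by
  set w : Fin n₁ → ℝ := fun p => (n₁ : ℝ) - (p.1 : ℝ) with hw
  have hpos (p : Fin n₁) : 0 < w p := sub_pos.2 (Nat.cast_lt.2 p.2)
  have hinj : Function.Injective w := fun p p' h => Fin.ext (by simpa [hw] using h)
  obtain ⟨U, hU, V, hV, hmax⟩ := exists_unitary_forall_re_trace_le (weightMatrix w n₂) A
  have hA : A = U * (Uᴴ * A * V) * Vᴴ := by
    have hU' : U * Uᴴ = 1 := (Unitary.mem_iff.1 hU).2
    have hV' : V * Vᴴ = 1 := (Unitary.mem_iff.1 hV).2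
    calc A = (U * Uᴴ) * A * (V * Vᴴ) := by rw [hU', hV', Matrix.one_mul, Matrix.mul_one]
      _ = _ := by simp only [Matrix.mul_assoc]
  set M := Uᴴ * A * V
  have hleft : ∀ W ∈ unitary (Matrix (Fin n₁) (Fin n₁) (Quaternion ℝ)),
      (W * (M * weightMatrix w n₂)).trace.re ≤ (M * weightMatrix w n₂).trace.re := by
    intro W hW
    have h := hmax W hW 1 (one_mem _)
    rwa [Matrix.mul_one, re_trace_mul_comm, re_trace_mul_comm _ M, Matrix.mul_assoc] at h
  have hright : ∀ Z ∈ unitary (Matrix (Fin n₂) (Fin n₂) (Quaternion ℝ)),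
      (Z * (weightMatrix w n₂ * M)).trace.re ≤ (weightMatrix w n₂ * M).trace.re := by
    intro Z hZ
    have h := hmax 1 (one_mem _) Z hZ
    rwa [Matrix.one_mul, ← Matrix.mul_assoc, re_trace_mul_comm _ Z] at h
  have hherm := conjTranspose_eq_of_re_trace_unitary_mul_le hleft
  have hdiag (p : Fin n₁) (q : Fin n₂) (hpq : p.1 ≠ q.1) : M p q = 0 :=
    apply_eq_zero_of_mul_weightMatrix_hermitian hpos hinj hherm
      (conjTranspose_eq_of_re_trace_unitary_mul_le hright) hpq
  have hreal (p : Fin n₁) (q : Fin n₂) : ((M p q).re : Quaternion ℝ) = M p q := by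
    by_cases hpq : p.1 = q.1
    · have h := congrFun (congrFun hherm p) p
      rw [Matrix.conjTranspose_apply, mul_weightMatrix_apply w M p hpq,
        Quaternion.mul_coe_eq_smul, Quaternion.star_smul] at h
      exact (Quaternion.star_eq_self.1 (smul_right_injective _ (hpos p).ne' h)).symm
    · rw [hdiag p q hpq, Quaternion.re_zero, Quaternion.coe_zero]
  refine ⟨U, V, M.map (fun x => x.re), (Unitary.mem_iff.1 hU).2, (Unitary.mem_iff.1 hU).1,
    (Unitary.mem_iff.1 hV).2, (Unitary.mem_iff.1 hV).1, fun p q => ?_, fun p q hpq => ?_,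
    fun p p' q q' hpq hpq' hle => ?_, ?_⟩
  · by_cases hpq : p.1 = q.1
    · have h := re_diag_nonneg_of_re_trace_unitary_mul_le hleft p
      rw [mul_weightMatrix_apply w M p hpq, Quaternion.mul_coe_eq_smul, Quaternion.re_smul,
        smul_eq_mul] at h
      exact nonneg_of_mul_nonneg_right h (hpos p)
    · rw [Matrix.map_apply, hdiag p q hpq, Quaternion.re_zero]
  · rw [Matrix.map_apply, hdiag p q hpq, Quaternion.re_zero]
  · rcases hle.eq_or_lt with heq | hlt
    · obtain rfl : p = p' := Fin.ext heq
      obtain rfl : q = q' := Fin.ext (hpq.symm.trans hpq')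
      exact le_rfl
    · refine re_apply_le_of_re_trace_swap_le (w := w) hpq hpq'
        (sub_lt_sub_left (Nat.cast_lt.2 hlt) _) ?_
      have h := hmax _ (one_submatrix_mem_unitary (Equiv.swap p p')) _
        (one_submatrix_mem_unitary (Equiv.swap q q'))
      rwa [one_submatrix_mul, mul_one_submatrix, Equiv.symm_swap, Matrix.submatrix_submatrix,
        Function.comp_id, Function.id_comp] at h
  · have hM : (M.map (fun x => x.re)).map (fun x : ℝ => (x : Quaternion ℝ)) = M := by
      ext1 p q
      exact hreal p q
    rw [hM]
    exact hA

end QTpaper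
end
end

section
/- Let A ∈ ℍ^{n₁×n₂} and suppose A = U D V* with U ∈ ℍ^{n₁×n₁}, V ∈ ℍ^{n₂×n₂} unitary and D an n₁×n₂ matrix with real nonnegative entries vanishing off the main diagonal. Then for every r ∈ ℕ and all X ∈ ℍ^{n₁×r}, Y ∈ ℍ^{n₂×r} with A = X Y*, one has Σᵢ Dᵢᵢ ≤ ‖X‖_F·‖Y‖_F ≤ ½(‖X‖_F² + ‖Y‖_F²); moreover, with r = min(n₁,n₂) there exist X ∈ ℍ^{n₁×r} and Y ∈ ℍ^{n₂×r} with A = X Y* and ‖X‖_F·‖Y‖_F = ½(‖X‖_F² + ‖Y‖_F²) = Σᵢ Dᵢᵢ. Hence the minimum of ‖X‖_F‖Y‖_F and the minimum of ½(‖X‖_F²+‖Y‖_F²) over all such factorizations both equal the nuclear norm Σᵢ Dᵢᵢ. -/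
noncomputable section
open Matrix Kronecker Filter Topology

namespace QTpaper

lemma frobM_nonneg {m n : ℕ} (M : Matrix (Fin m) (Fin n) (Quaternion ℝ)) : 0 ≤ frobM M :=
  Real.sqrt_nonneg _

lemma coe_frobM_sq {m n : ℕ} (M : Matrix (Fin m) (Fin n) (Quaternion ℝ)) :
    ((frobM M ^ 2 : ℝ) : Quaternion ℝ) = (Mᴴ * M).trace := by
  rw [frobM, Real.sq_sqrt (by positivity), Finset.sum_comm]
  simp only [Matrix.trace, Matrix.diag, Matrix.mul_apply, Matrix.conjTranspose_apply,
    Quaternion.star_mul_self, Quaternion.normSq_eq_norm_mul_self, ← sq]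
  simp only [← Quaternion.algebraMap_def, map_sum]

/-- The Frobenius norm is invariant under left multiplication by a unitary matrix. -/
lemma frobM_mul_of_conjTranspose_mul_self {m n : ℕ} {W : Matrix (Fin m) (Fin m) (Quaternion ℝ)}
    (hW : Wᴴ * W = 1) (M : Matrix (Fin m) (Fin n) (Quaternion ℝ)) :
    frobM (W * M) = frobM M := by
  rw [← sq_eq_sq₀ (frobM_nonneg _) (frobM_nonneg _)]
  apply Quaternion.coe_injective
  rw [coe_frobM_sq, coe_frobM_sq, Matrix.conjTranspose_mul, Matrix.mul_assoc,
    ← Matrix.mul_assoc Wᴴ, hW, Matrix.one_mul]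

lemma sum_sum_norm_sq_comp_le_frobM_sq {m n s : ℕ} (M : Matrix (Fin m) (Fin n) (Quaternion ℝ))
    {f : Fin s → Fin m} (hf : Function.Injective f) :
    ∑ i, ∑ k, ‖M (f i) k‖ ^ 2 ≤ frobM M ^ 2 := by
  rw [frobM, Real.sq_sqrt (by positivity),
    ← Finset.sum_image (s := Finset.univ) (f := fun p => ∑ k, ‖M p k‖ ^ 2)
      (fun _ _ _ _ h => hf h)]
  exact Finset.sum_le_univ_sum_of_nonneg fun p => by positivity

/-- Cauchy–Schwarz bound for sums of entries of `P * Qᴴ` in distinct rows and columns. -/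
lemma sum_norm_mul_conjTranspose_le {m n r s : ℕ} (P : Matrix (Fin m) (Fin r) (Quaternion ℝ))
    (Q : Matrix (Fin n) (Fin r) (Quaternion ℝ)) {f : Fin s → Fin m} {g : Fin s → Fin n}
    (hf : Function.Injective f) (hg : Function.Injective g) :
    ∑ i, ‖(P * Qᴴ) (f i) (g i)‖ ≤ frobM P * frobM Q := by
  calc ∑ i, ‖(P * Qᴴ) (f i) (g i)‖
      ≤ ∑ i, ∑ k, ‖P (f i) k‖ * ‖Q (g i) k‖ := by
        refine Finset.sum_le_sum fun i _ => ?_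
        rw [Matrix.mul_apply]
        refine (norm_sum_le _ _).trans_eq (Finset.sum_congr rfl fun k _ => ?_)
        rw [norm_mul, Matrix.conjTranspose_apply, norm_star]
    _ = ∑ x : Fin s × Fin r, ‖P (f x.1) x.2‖ * ‖Q (g x.1) x.2‖ := by
        rw [Fintype.sum_prod_type]
    _ ≤ √(∑ x : Fin s × Fin r, ‖P (f x.1) x.2‖ ^ 2) *
          √(∑ x : Fin s × Fin r, ‖Q (g x.1) x.2‖ ^ 2) :=
        Real.sum_mul_le_sqrt_mul_sqrt _ _ _
    _ ≤ frobM P * frobM Q := by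
        simp only [Fintype.sum_prod_type]
        exact mul_le_mul
          (Real.sqrt_le_iff.2 ⟨frobM_nonneg _, sum_sum_norm_sq_comp_le_frobM_sq P hf⟩)
          (Real.sqrt_le_iff.2 ⟨frobM_nonneg _, sum_sum_norm_sq_comp_le_frobM_sq Q hg⟩)
          (Real.sqrt_nonneg _) (frobM_nonneg _)

/-- The rectangular diagonal matrix with entries `√(d i)`. -/
def sqrtDiag (n : ℕ) {r : ℕ} (d : Fin r → ℝ) : Matrix (Fin n) (Fin r) (Quaternion ℝ) :=
  fun p i => if p.1 = i.1 then ((√(d i) : ℝ) : Quaternion ℝ) else 0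

lemma frobM_sqrtDiag {n r : ℕ} (hr : r ≤ n) {d : Fin r → ℝ} (hd : ∀ i, 0 ≤ d i) :
    frobM (sqrtDiag n d) = √(∑ i, d i) := by
  rw [frobM, Finset.sum_comm]
  congr 1
  refine Finset.sum_congr rfl fun i _ => ?_
  rw [Finset.sum_eq_single (Fin.castLE hr i)]
  · simp [sqrtDiag, Quaternion.norm_coe, Real.sq_sqrt (hd i)]
  · intro p _ hp
    have : p.1 ≠ i.1 := fun h => hp (Fin.ext h)
    simp [sqrtDiag, this]
  · simp

lemma sqrtDiag_mul_conjTranspose {n₁ n₂ : ℕ} {D : Matrix (Fin n₁) (Fin n₂) ℝ}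
    (hDpos : ∀ p q, 0 ≤ D p q) (hDoff : ∀ p q, p.1 ≠ q.1 → D p q = 0)
    {d : Fin (min n₁ n₂) → ℝ}
    (hd : ∀ i, d i = D (Fin.castLE (min_le_left n₁ n₂) i) (Fin.castLE (min_le_right n₁ n₂) i)) :
    sqrtDiag n₁ d * (sqrtDiag n₂ d)ᴴ = D.map (fun x => (x : Quaternion ℝ)) := by
  ext1 p q
  rw [Matrix.mul_apply, Matrix.map_apply]
  simp only [Matrix.conjTranspose_apply, sqrtDiag]
  by_cases h : p.1 = q.1
  · rw [Finset.sum_eq_single ⟨p.1, lt_min p.2 (h ▸ q.2)⟩]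
    · have hD : d ⟨p.1, lt_min p.2 (h ▸ q.2)⟩ = D p q := by
        rw [hd]
        congr 1
        exact Fin.ext h
      simp only [h, if_true, Quaternion.star_coe] at hD ⊢
      rw [hD, ← Quaternion.coe_mul, Real.mul_self_sqrt (hDpos p q)]
    · intro i _ hi
      have : p.1 ≠ i.1 := fun h => hi (Fin.ext h.symm)
      simp [this]
    · simp
  · rw [hDoff p q h, Quaternion.coe_zero]
    refine Finset.sum_eq_zero fun i _ => ?_
    by_cases hp : p.1 = i.1
    · have : q.1 ≠ i.1 := fun hq => h (hp.trans hq.symm)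
      simp [this]
    · simp [hp]

/-- the nuclear norm equals the minimal factorization energy. -/
theorem quaternion_nuclear_norm_factorization {n₁ n₂ : ℕ}
    (A : Matrix (Fin n₁) (Fin n₂) (Quaternion ℝ))
    (U : Matrix (Fin n₁) (Fin n₁) (Quaternion ℝ))
    (V : Matrix (Fin n₂) (Fin n₂) (Quaternion ℝ))
    (D : Matrix (Fin n₁) (Fin n₂) ℝ)
    (hU : U * Uᴴ = 1 ∧ Uᴴ * U = 1) (hV : V * Vᴴ = 1 ∧ Vᴴ * V = 1)
    (hDpos : ∀ p q, 0 ≤ D p q)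
    (hDoff : ∀ p q, p.1 ≠ q.1 → D p q = 0)
    (hA : A = U * D.map (fun x => (x : Quaternion ℝ)) * Vᴴ) :
    (∀ (r : ℕ) (X : Matrix (Fin n₁) (Fin r) (Quaternion ℝ))
        (Y : Matrix (Fin n₂) (Fin r) (Quaternion ℝ)), A = X * Yᴴ →
        (∑ i : Fin (min n₁ n₂),
            D (Fin.castLE (min_le_left n₁ n₂) i) (Fin.castLE (min_le_right n₁ n₂) i))
          ≤ frobM X * frobM Y ∧
        frobM X * frobM Y ≤ (frobM X ^ 2 + frobM Y ^ 2) / 2) ∧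
    ∃ (X : Matrix (Fin n₁) (Fin (min n₁ n₂)) (Quaternion ℝ))
      (Y : Matrix (Fin n₂) (Fin (min n₁ n₂)) (Quaternion ℝ)),
      A = X * Yᴴ ∧
      frobM X * frobM Y
        = ∑ i : Fin (min n₁ n₂),
            D (Fin.castLE (min_le_left n₁ n₂) i) (Fin.castLE (min_le_right n₁ n₂) i) ∧
      (frobM X ^ 2 + frobM Y ^ 2) / 2
        = ∑ i : Fin (min n₁ n₂),
            D (Fin.castLE (min_le_left n₁ n₂) i) (Fin.castLE (min_le_right n₁ n₂) i) := by
  constructor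
  · intro r X Y hXY
    refine ⟨?_, by nlinarith [sq_nonneg (frobM X - frobM Y)]⟩
    have hD : D.map (fun x => (x : Quaternion ℝ)) = (Uᴴ * X) * (Vᴴ * Y)ᴴ := by
      calc D.map (fun x => (x : Quaternion ℝ))
          = (Uᴴ * U) * D.map (fun x => (x : Quaternion ℝ)) * (Vᴴ * V) := by
            rw [hU.2, hV.2, Matrix.one_mul, Matrix.mul_one]
        _ = Uᴴ * A * V := by rw [hA]; simp only [Matrix.mul_assoc]
        _ = (Uᴴ * X) * (Vᴴ * Y)ᴴ := by
            rw [hXY, Matrix.conjTranspose_mul, Matrix.conjTranspose_conjTranspose]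
            simp only [Matrix.mul_assoc]
    have hU' : Uᴴᴴ * Uᴴ = 1 := by rw [Matrix.conjTranspose_conjTranspose, hU.1]
    have hV' : Vᴴᴴ * Vᴴ = 1 := by rw [Matrix.conjTranspose_conjTranspose, hV.1]
    have key := sum_norm_mul_conjTranspose_le (Uᴴ * X) (Vᴴ * Y)
      (Fin.castLE_injective (min_le_left n₁ n₂)) (Fin.castLE_injective (min_le_right n₁ n₂))
    rw [← hD, frobM_mul_of_conjTranspose_mul_self hU',
      frobM_mul_of_conjTranspose_mul_self hV'] at key
    simpa only [Matrix.map_apply, Quaternion.norm_coe, Real.norm_eq_abs,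
      abs_of_nonneg (hDpos _ _)] using key
  · set d : Fin (min n₁ n₂) → ℝ := fun i =>
      D (Fin.castLE (min_le_left n₁ n₂) i) (Fin.castLE (min_le_right n₁ n₂) i)
    have hd0 : ∀ i, 0 ≤ d i := fun i => hDpos _ _
    have hsum : 0 ≤ ∑ i, d i := Finset.sum_nonneg fun i _ => hd0 i
    refine ⟨U * sqrtDiag n₁ d, V * sqrtDiag n₂ d, ?_, ?_, ?_⟩
    · rw [hA, ← sqrtDiag_mul_conjTranspose hDpos hDoff (d := d) fun _ => rfl,
        Matrix.conjTranspose_mul]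
      simp only [Matrix.mul_assoc]
    all_goals
      rw [frobM_mul_of_conjTranspose_mul_self hU.2, frobM_mul_of_conjTranspose_mul_self hV.2,
        frobM_sqrtDiag (min_le_left n₁ n₂) hd0, frobM_sqrtDiag (min_le_right n₁ n₂) hd0]
    · exact Real.mul_self_sqrt hsum
    · rw [Real.sq_sqrt hsum, add_self_div_two]

end QTpaper
end
end

section
/- Let μ₁ and μ₂ be unit pure quaternions and n ≥ 1. Then F_{μ₁,n}*·F_{μ₂,n} = ½(1 − μ₁μ₂)·I_n + ½(1 + μ₁μ₂)·P_n and F_{μ₁,n}·F_{μ₂,n} = ½(1 + μ₁μ₂)·I_n + ½(1 − μ₁μ₂)·P_n, where the quaternion scalars ½(1 ∓ μ₁μ₂) multiply the real matrices I_n and P_n entrywise from the left. -/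
noncomputable section
open Matrix Kronecker Filter Topology

namespace QTpaper

lemma sum_exp_two_pi_mul_div (n : ℕ) (hn : n ≠ 0) (k : ℤ) :
    ∑ m : Fin n, Complex.exp ((2 * Real.pi * (m.1 * k) / n : ℝ) * Complex.I)
      = if (n : ℤ) ∣ k then (n : ℂ) else 0 := by
  set ζ : ℂ := Complex.exp (2 * Real.pi * Complex.I / n) with hζ
  have hp : IsPrimitiveRoot ζ n := Complex.isPrimitiveRoot_exp n hn
  have hterm (m : Fin n) :
      Complex.exp ((2 * Real.pi * (m.1 * k) / n : ℝ) * Complex.I) = (ζ ^ k) ^ m.1 := by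
    rw [hζ, ← Complex.exp_int_mul, ← Complex.exp_nat_mul]
    congr 1
    push_cast
    ring
  rw [Finset.sum_congr rfl fun m _ => hterm m, Fin.sum_univ_eq_sum_range (fun m => (ζ ^ k) ^ m)]
  split_ifs with h
  · simp [(hp.zpow_eq_one_iff_dvd k).2 h]
  · have hne : ζ ^ k - 1 ≠ 0 := sub_ne_zero.2 fun h' => h ((hp.zpow_eq_one_iff_dvd k).1 h')
    have hmul := mul_geom_sum (ζ ^ k) n
    rw [← zpow_natCast, zpow_comm, zpow_natCast, hp.pow_eq_one, _root_.one_zpow, sub_self] at hmul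
    exact (mul_eq_zero.1 hmul).resolve_left hne

lemma sum_cos_two_pi_mul_div (n : ℕ) (hn : n ≠ 0) (k : ℤ) :
    ∑ m : Fin n, Real.cos (2 * Real.pi * (m.1 * k) / n)
      = if (n : ℤ) ∣ k then (n : ℝ) else 0 := by
  have h := congrArg Complex.re (sum_exp_two_pi_mul_div n hn k)
  simp only [Complex.re_sum, Complex.exp_ofReal_mul_I_re] at h
  rw [h]
  split_ifs <;> simp

lemma sum_sin_two_pi_mul_div (n : ℕ) (hn : n ≠ 0) (k : ℤ) :
    ∑ m : Fin n, Real.sin (2 * Real.pi * (m.1 * k) / n) = 0 := by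
  have h := congrArg Complex.im (sum_exp_two_pi_mul_div n hn k)
  simp only [Complex.im_sum, Complex.exp_ofReal_mul_I_im] at h
  rw [h]
  split_ifs <;> simp

lemma sum_cos_sub {n : ℕ} (p q : Fin n) :
    ∑ m : Fin n, Real.cos (2 * Real.pi * (m.1 * p.1) / n - 2 * Real.pi * (m.1 * q.1) / n)
      = n * (1 : Matrix (Fin n) (Fin n) ℝ) p q := by
  have hp := p.2
  have hq := q.2
  have h := sum_cos_two_pi_mul_div n (by omega) ((p.1 : ℤ) - q.1)
  have hdvd : (n : ℤ) ∣ (p.1 : ℤ) - q.1 ↔ p = q := by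
    constructor
    · intro hd
      have := Int.eq_zero_of_abs_lt_dvd hd (by rw [abs_lt]; omega)
      exact Fin.ext (by omega)
    · rintro rfl
      simp
  simp only [hdvd] at h
  rw [Matrix.one_apply, mul_ite, mul_one, mul_zero, ← h]
  refine Finset.sum_congr rfl fun m _ => ?_
  congr 1
  push_cast
  ring

lemma sum_cos_add {n : ℕ} (p q : Fin n) :
    ∑ m : Fin n, Real.cos (2 * Real.pi * (m.1 * p.1) / n + 2 * Real.pi * (m.1 * q.1) / n)
      = n * Pmat n p q := by
  have hp := p.2
  have hq := q.2
  have h := sum_cos_two_pi_mul_div n (by omega) ((p.1 : ℤ) + q.1)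
  have hdvd : (n : ℤ) ∣ (p.1 : ℤ) + q.1 ↔ (p.1 = 0 ∧ q.1 = 0) ∨ p.1 + q.1 = n := by
    constructor
    · rintro ⟨c, hc⟩
      have hc0 : 0 ≤ c := by nlinarith
      have hc2 : c < 2 := by nlinarith
      interval_cases c <;> omega
    · rintro (⟨h0, h0'⟩ | h1)
      · simp [h0, h0']
      · exact ⟨1, by omega⟩
  simp only [hdvd] at h
  rw [Pmat, mul_ite, mul_one, mul_zero, ← h]
  refine Finset.sum_congr rfl fun m _ => ?_
  congr 1
  push_cast
  ring

lemma sum_cos_mul_cos {n : ℕ} (p q : Fin n) :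
    ∑ m : Fin n, Real.cos (2 * Real.pi * (m.1 * p.1) / n) * Real.cos (2 * Real.pi * (m.1 * q.1) / n)
      = n * (((1 : Matrix (Fin n) (Fin n) ℝ) p q + Pmat n p q) / 2) := by
  have h1 := sum_cos_sub p q
  have h2 := sum_cos_add p q
  simp only [Real.cos_sub, Real.cos_add, Finset.sum_add_distrib, Finset.sum_sub_distrib] at h1 h2
  linarith

lemma sum_sin_mul_sin {n : ℕ} (p q : Fin n) :
    ∑ m : Fin n, Real.sin (2 * Real.pi * (m.1 * p.1) / n) * Real.sin (2 * Real.pi * (m.1 * q.1) / n)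
      = n * (((1 : Matrix (Fin n) (Fin n) ℝ) p q - Pmat n p q) / 2) := by
  have h1 := sum_cos_sub p q
  have h2 := sum_cos_add p q
  simp only [Real.cos_sub, Real.cos_add, Finset.sum_add_distrib, Finset.sum_sub_distrib] at h1 h2
  linarith

lemma sum_sin_mul_cos {n : ℕ} (p q : Fin n) :
    ∑ m : Fin n, Real.sin (2 * Real.pi * (m.1 * p.1) / n) * Real.cos (2 * Real.pi * (m.1 * q.1) / n)
      = 0 := by
  have hn : n ≠ 0 := by have := p.2; omega
  have h1 := sum_sin_two_pi_mul_div n hn ((p.1 : ℤ) + q.1)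
  have h2 := sum_sin_two_pi_mul_div n hn ((p.1 : ℤ) - q.1)
  push_cast at h1 h2
  simp only [mul_add, mul_sub, add_div, sub_div, Real.sin_sub, Real.sin_add,
    Finset.sum_add_distrib, Finset.sum_sub_distrib] at h1 h2
  linarith

lemma Fq_transpose (μ : Quaternion ℝ) (n : ℕ) : (Fq μ n)ᵀ = Fq μ n := by
  ext1 p q
  simp only [Matrix.transpose_apply, Fq, mul_comm (q.1 : ℝ)]

/-- Conjugation replaces `μ` by `-μ`. -/
lemma Fq_conjTranspose {μ : Quaternion ℝ} (hμ : μ.re = 0) (n : ℕ) :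
    (Fq μ n)ᴴ = Fq (-μ) n := by
  have hstar : star μ = -μ := Quaternion.star_eq_neg.2 hμ
  rw [Matrix.conjTranspose, Fq_transpose]
  ext1 p q
  simp only [Matrix.map_apply, Fq, star_mul, star_sub, Quaternion.star_coe, hstar,
    Quaternion.coe_commutes]

lemma Fq_mul_Fq (μ ν : Quaternion ℝ) (n : ℕ) :
    Fq μ n * Fq ν n
      = ((1 + μ * ν) / 2) • ((1 : Matrix (Fin n) (Fin n) ℝ).map (fun x => (x : Quaternion ℝ)))
        + ((1 - μ * ν) / 2) • ((Pmat n).map (fun x => (x : Quaternion ℝ))) := by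
  ext1 p q
  have hn : (n : ℝ) ≠ 0 := by have := p.2; exact_mod_cast (by omega : n ≠ 0)
  have hterm (m : Fin n) : Fq μ n p m * Fq ν n m q
      = (n : ℝ)⁻¹ • (
        (Real.cos (2 * Real.pi * (m.1 * p.1) / n) * Real.cos (2 * Real.pi * (m.1 * q.1) / n))
          • (1 : Quaternion ℝ)
        + (Real.sin (2 * Real.pi * (m.1 * p.1) / n) * Real.sin (2 * Real.pi * (m.1 * q.1) / n))
          • (μ * ν)
        - (Real.sin (2 * Real.pi * (m.1 * p.1) / n) * Real.cos (2 * Real.pi * (m.1 * q.1) / n)) • μ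
        - (Real.sin (2 * Real.pi * (m.1 * q.1) / n) * Real.cos (2 * Real.pi * (m.1 * p.1) / n))
          • ν) := by
    have hs : (n : ℝ)⁻¹ = (1 / Real.sqrt n) * (1 / Real.sqrt n) := by
      rw [← mul_div_mul_comm, Real.mul_self_sqrt n.cast_nonneg, one_mul, one_div]
    rw [hs, ← Fq_transpose μ n]
    simp only [Matrix.transpose_apply, Fq, Quaternion.coe_mul_eq_smul, sub_mul,
      mul_sub, Quaternion.mul_coe_eq_smul, smul_mul_assoc, mul_smul_comm]
    rw [← mul_one (Quaternion.coe _), Quaternion.coe_mul_eq_smul]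
    module
  rw [Matrix.mul_apply, Finset.sum_congr rfl fun m _ => hterm m, ← Finset.smul_sum]
  simp only [Finset.sum_add_distrib, Finset.sum_sub_distrib, ← Finset.sum_smul]
  rw [sum_cos_mul_cos, sum_sin_mul_sin, sum_sin_mul_cos, sum_sin_mul_cos]
  have hhalf (x : Quaternion ℝ) : x / 2 = (2⁻¹ : ℝ) • x := by
    have h2 : (2 : Quaternion ℝ) = ((2 : ℝ) : Quaternion ℝ) :=
      (map_ofNat (algebraMap ℝ (Quaternion ℝ)) 2).symm
    rw [div_eq_mul_inv, h2, ← Quaternion.coe_inv, Quaternion.mul_coe_eq_smul]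
  simp only [Matrix.add_apply, Matrix.smul_apply, Matrix.map_apply, smul_eq_mul,
    Quaternion.mul_coe_eq_smul, hhalf]
  match_scalars <;> field_simp <;> ring

/-- products of QDFT matrices with different pure-quaternion bases. -/
theorem qdft_matrix_products (μ₁ μ₂ : Quaternion ℝ)
    (h₁ : UnitPure μ₁) (h₂ : UnitPure μ₂) (n : ℕ) (hn : 1 ≤ n) :
    (Fq μ₁ n)ᴴ * Fq μ₂ n
        = ((1 - μ₁ * μ₂) / 2) • ((1 : Matrix (Fin n) (Fin n) ℝ).map (fun x => (x : Quaternion ℝ)))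
          + ((1 + μ₁ * μ₂) / 2) • ((Pmat n).map (fun x => (x : Quaternion ℝ))) ∧
    Fq μ₁ n * Fq μ₂ n
        = ((1 + μ₁ * μ₂) / 2) • ((1 : Matrix (Fin n) (Fin n) ℝ).map (fun x => (x : Quaternion ℝ)))
          + ((1 - μ₁ * μ₂) / 2) • ((Pmat n).map (fun x => (x : Quaternion ℝ))) := by
  refine ⟨?_, Fq_mul_Fq μ₁ μ₂ n⟩
  rw [Fq_conjTranspose h₁.1, Fq_mul_Fq, neg_mul, ← sub_eq_add_neg, sub_neg_eq_add]

end QTpaper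
end
end

section
/- Let μ be a unit pure quaternion and A ∈ ℝ^{n₁×n₂×n₃} a real third-order tensor, viewed inside ℍ^{n₁×n₂×n₃}. Then (F_{μ,n₃} ⊗ I_{n₁}) · circ(A) · (F_{μ,n₃}* ⊗ I_{n₂}) = diag(fft(A)); that is, this product is the block diagonal matrix whose l-th diagonal block is the l-th frontal slice of fft(A) and whose off-diagonal blocks vanish. -/
noncomputable section
open Matrix Kronecker Filter Topology

namespace QTpaper

/-- The embedding of `ℂ` into the quaternions sending the imaginary unit to `-μ`. -/
def UnitPure.lift {μ : Quaternion ℝ} (hμ : UnitPure μ) : ℂ →ₐ[ℝ] Quaternion ℝ :=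
  Complex.lift ⟨-μ, by
    have h : μ ^ 2 = -((Quaternion.normSq μ : ℝ) : Quaternion ℝ) :=
      Quaternion.sq_eq_neg_normSq.mpr hμ.1
    rw [Quaternion.normSq_eq_norm_mul_self, hμ.2] at h
    rw [neg_mul_neg, ← sq, h]
    simp⟩

theorem UnitPure.lift_apply {μ : Quaternion ℝ} (hμ : UnitPure μ) (z : ℂ) :
    hμ.lift z = ((z.re : ℝ) : Quaternion ℝ) - ((z.im : ℝ) : Quaternion ℝ) * μ := by
  simp only [UnitPure.lift, Complex.lift_apply, Complex.liftAux_apply, smul_neg,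
    Quaternion.coe_mul_eq_smul, sub_eq_add_neg]
  rfl

theorem UnitPure.lift_ofReal {μ : Quaternion ℝ} (hμ : UnitPure μ) (r : ℝ) :
    hμ.lift (r : ℂ) = (r : Quaternion ℝ) := by
  simp [hμ.lift_apply]

theorem UnitPure.star_lift {μ : Quaternion ℝ} (hμ : UnitPure μ) (z : ℂ) :
    star (hμ.lift z) = hμ.lift (star z) := by
  have h : star μ = -μ := Quaternion.star_eq_neg.mpr hμ.1
  simp [hμ.lift_apply, h, Quaternion.coe_commutes]

/-- The complex root of unity `exp (2πi/n)`. -/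
def zetaC (n : ℕ) : ℂ := Complex.exp (2 * Real.pi * Complex.I / n)

theorem UnitPure.Fq_eq_lift {μ : Quaternion ℝ} (hμ : UnitPure μ) {n : ℕ} (p q : Fin n) :
    Fq μ n p q = hμ.lift (((1 / Real.sqrt n : ℝ) : ℂ) * zetaC n ^ (p.1 * q.1)) := by
  have h : zetaC n ^ (p.1 * q.1)
      = Complex.exp (((2 * Real.pi * (p.1 * q.1) / n : ℝ) : ℂ) * Complex.I) := by
    rw [zetaC, ← Complex.exp_nat_mul]
    congr 1
    push_cast
    ring
  rw [map_mul, hμ.lift_ofReal, hμ.lift_apply, h, Complex.exp_ofReal_mul_I_re,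
    Complex.exp_ofReal_mul_I_im, Fq]

theorem zetaC_pow_mul_add {n : ℕ} (l k m : Fin n) :
    zetaC n ^ (l.1 * (k + m).1) = zetaC n ^ (l.1 * k.1) * zetaC n ^ (l.1 * m.1) := by
  have hn : n ≠ 0 := l.pos.ne'
  have h1 : zetaC n ^ n = 1 := (Complex.isPrimitiveRoot_exp n hn).pow_eq_one
  rw [← pow_add, ← mul_add, mul_comm, mul_comm l.1, pow_mul, pow_mul, Fin.val_add,
    ← pow_eq_pow_mod _ h1]

theorem sum_zetaC_pow_mul_star {n : ℕ} (l l' : Fin n) :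
    ∑ m : Fin n, zetaC n ^ (l.1 * m.1) * star (zetaC n ^ (l'.1 * m.1))
      = if l = l' then (n : ℂ) else 0 := by
  have hn : n ≠ 0 := l.pos.ne'
  have hp : IsPrimitiveRoot (zetaC n) n := Complex.isPrimitiveRoot_exp n hn
  have h1 : zetaC n ^ n = 1 := hp.pow_eq_one
  have hnorm : ‖zetaC n‖ = 1 := hp.norm'_eq_one hn
  have h0 : zetaC n ≠ 0 := hp.ne_zero hn
  have hinv : star (zetaC n) = (zetaC n)⁻¹ := by
    rw [Complex.inv_eq_conj hnorm]; rfl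
  set r : ℂ := zetaC n ^ l.1 * (zetaC n ^ l'.1)⁻¹ with hr
  have hterm (m : Fin n) :
      zetaC n ^ (l.1 * m.1) * star (zetaC n ^ (l'.1 * m.1)) = r ^ m.1 := by
    rw [star_pow, hinv, hr, pow_mul, pow_mul, mul_pow, inv_pow]
  simp only [hterm]
  rw [Fin.sum_univ_eq_sum_range (fun m => r ^ m) n]
  split_ifs with h
  · have : r = 1 := by rw [hr, h, mul_inv_cancel₀ (pow_ne_zero _ h0)]
    simp [this]
  · have hr1 : r ≠ 1 := by
      intro hr1
      rw [hr, mul_inv_eq_one₀ (pow_ne_zero _ h0)] at hr1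
      exact h (Fin.ext (hp.pow_inj l.2 l'.2 hr1))
    have hrn : r ^ n = 1 := by
      rw [hr, mul_pow, inv_pow, pow_right_comm, pow_right_comm _ l'.1, h1]
      simp
    rw [geom_sum_eq hr1, hrn, sub_self, zero_div]

/-- The discrete Fourier transform diagonalizes a circulant matrix. -/
theorem sum_dft_circulant {n : ℕ} (a : Fin n → ℂ) (s : ℂ) (hs : s * star s * n = 1)
    (l l' : Fin n) :
    ∑ m' : Fin n, (∑ m : Fin n, (s * zetaC n ^ (l.1 * m.1)) * a (m - m'))
        * star (s * zetaC n ^ (l'.1 * m'.1))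
      = if l = l' then ∑ m : Fin n, zetaC n ^ (l.1 * m.1) * a m else 0 := by
  have : NeZero n := ⟨l.pos.ne'⟩
  have hshift (m' : Fin n) : ∑ m : Fin n, (s * zetaC n ^ (l.1 * m.1)) * a (m - m')
      = s * zetaC n ^ (l.1 * m'.1) * ∑ m : Fin n, zetaC n ^ (l.1 * m.1) * a m := by
    rw [← Equiv.sum_comp (Equiv.addRight m'), Finset.mul_sum]
    refine Finset.sum_congr rfl fun k _ => ?_
    simp only [Equiv.coe_addRight, add_sub_cancel_right, zetaC_pow_mul_add]
    ring
  have hsum := sum_zetaC_pow_mul_star l l'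
  calc _ = (s * star s) * (∑ m : Fin n, zetaC n ^ (l.1 * m.1) * a m) *
        ∑ m' : Fin n, zetaC n ^ (l.1 * m'.1) * star (zetaC n ^ (l'.1 * m'.1)) := by
        rw [Finset.mul_sum]
        refine Finset.sum_congr rfl fun m' _ => ?_
        rw [hshift, star_mul']
        ring
    _ = _ := by
        rw [hsum]
        split_ifs
        · linear_combination (∑ m : Fin n, zetaC n ^ (l.1 * m.1) * a m) * hs
        · simp

/-- the QDFT block-diagonalizes the block circulant matrix of a real tensor. -/
theorem real_circulant_block_diagonalization {n₁ n₂ n₃ : ℕ}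
    (μ : Quaternion ℝ) (hμ : UnitPure μ) (A : Fin n₁ → Fin n₂ → Fin n₃ → ℝ) :
    (Fq μ n₃ ⊗ₖ (1 : Matrix (Fin n₁) (Fin n₁) (Quaternion ℝ)))
        * circ (fun p q l => ((A p q l : ℝ) : Quaternion ℝ))
        * ((Fq μ n₃)ᴴ ⊗ₖ (1 : Matrix (Fin n₂) (Fin n₂) (Quaternion ℝ)))
      = diagT (fftT μ (fun p q l => ((A p q l : ℝ) : Quaternion ℝ))) := by
  refine Matrix.ext ?_
  rintro ⟨l, p⟩ ⟨l', q⟩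
  have hn : (0 : ℝ) < n₃ := by exact_mod_cast l.pos
  have hsq : Real.sqrt n₃ ≠ 0 := (Real.sqrt_pos.mpr hn).ne'
  have hs : ((1 / Real.sqrt n₃ : ℝ) : ℂ) * star ((1 / Real.sqrt n₃ : ℝ) : ℂ) * n₃ = 1 := by
    have h : (1 / Real.sqrt n₃) * (1 / Real.sqrt n₃) * (n₃ : ℝ) = 1 := by
      field_simp
      rw [Real.sq_sqrt hn.le]
    rw [Complex.star_def, Complex.conj_ofReal]
    exact_mod_cast h
  have key := congrArg hμ.lift
    (sum_dft_circulant (fun m => (A p q m : ℂ)) _ hs l l')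
  simp only [map_sum, map_mul _ (∑ m, _) _, map_mul _ (_ * _ ^ _) (Complex.ofReal _),
    ← hμ.star_lift, ← hμ.Fq_eq_lift, hμ.lift_ofReal, apply_ite hμ.lift, map_zero] at key
  have hfft : fftT μ (fun p q l => ((A p q l : ℝ) : Quaternion ℝ)) p q l
      = hμ.lift (∑ m, zetaC n₃ ^ (l.1 * m.1) * (A p q m : ℂ)) := by
    simp only [fftT, hμ.Fq_eq_lift, ← hμ.lift_ofReal, ← map_mul, ← map_sum, Finset.mul_sum]
    congr 1
    refine Finset.sum_congr rfl fun m _ => ?_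
    have h : ((Real.sqrt n₃ : ℝ) : ℂ) * ((1 / Real.sqrt n₃ : ℝ) : ℂ) = 1 := by
      exact_mod_cast mul_one_div_cancel hsq
    linear_combination (zetaC n₃ ^ (l.1 * m.1) * (A p q m : ℂ)) * h
  rw [diagT]
  simp only [hfft]
  simp only [Matrix.mul_apply, Fintype.sum_prod_type, Matrix.kroneckerMap_apply, circ,
    Matrix.one_apply, mul_ite, mul_one, mul_zero, ite_mul, zero_mul, Finset.sum_ite_eq,
    Finset.sum_ite_eq', Finset.mem_univ, if_true, Matrix.conjTranspose_apply]
  simpa only [map_sum] using key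

end QTpaper
end
end

section
/- Let μ be a unit pure quaternion, A ∈ ℍ^{n₁×r×n₃}, B ∈ ℍ^{r×n₂×n₃}, and C ∈ ℍ^{n₁×n₂×n₃}. Then C = A *_μ B if and only if for every l ∈ {1,…,n₃} the l-th frontal slice of fft(C) equals the product of the corresponding frontal slices of fft(A) and fft(B): Ĉ^{(l)} = Â^{(l)}·B̂^{(l)} (equivalently, diag(fft(C)) = diag(fft(A))·diag(fft(B))). -/
noncomputable section
open Matrix Kronecker Filter Topology

namespace QTpaper

/-- The complex root of unity `exp (-2πi/n)`. -/
def dftRoot (n : ℕ) : ℂ := (Complex.exp (2 * Real.pi * Complex.I / n))⁻¹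

/-- The complex normalized DFT matrix. -/
def dftC (n : ℕ) : Matrix (Fin n) (Fin n) ℂ :=
  fun p q => ((1 / Real.sqrt n : ℝ) : ℂ) * dftRoot n ^ (p.1 * q.1)

lemma dftRoot_isPrimitiveRoot {n : ℕ} (hn : n ≠ 0) : IsPrimitiveRoot (dftRoot n) n :=
  (Complex.isPrimitiveRoot_exp n hn).inv

lemma dftRoot_eq_exp (n : ℕ) :
    dftRoot n = Complex.exp ((-(2 * Real.pi / n) : ℝ) * Complex.I) := by
  rw [dftRoot, ← Complex.exp_neg]
  congr 1
  push_cast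
  ring

lemma dftRoot_pow (n m : ℕ) :
    dftRoot n ^ m = ⟨Real.cos (2 * Real.pi * m / n), -Real.sin (2 * Real.pi * m / n)⟩ := by
  have h : dftRoot n ^ m = Complex.exp ((-(2 * Real.pi * m / n) : ℝ) * Complex.I) := by
    rw [dftRoot_eq_exp, ← Complex.exp_nat_mul]
    congr 1
    push_cast
    ring
  rw [h]
  apply Complex.ext
  · rw [Complex.exp_ofReal_mul_I_re, Real.cos_neg]
  · rw [Complex.exp_ofReal_mul_I_im, Real.sin_neg]

lemma conj_dftRoot (n : ℕ) : star (dftRoot n) = (dftRoot n)⁻¹ := by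
  rw [dftRoot_eq_exp, ← Complex.exp_neg, Complex.star_def, ← Complex.exp_conj, map_mul,
    Complex.conj_ofReal, Complex.conj_I, mul_neg]

lemma dftC_mul_conjTranspose (n : ℕ) : dftC n * (dftC n)ᴴ = 1 := by
  ext l k
  have hn : n ≠ 0 := by rintro rfl; exact l.elim0
  have hζ := dftRoot_isPrimitiveRoot hn
  have h0 : dftRoot n ≠ 0 := hζ.ne_zero hn
  have hsq : ((1 / Real.sqrt n : ℝ) : ℂ) * ((1 / Real.sqrt n : ℝ) : ℂ) = (n : ℂ)⁻¹ := by
    rw [← Complex.ofReal_mul, div_mul_div_comm, Real.mul_self_sqrt (Nat.cast_nonneg n)]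
    simp
  have hterm : ∀ m : Fin n, dftC n l m * (dftC n)ᴴ m k
      = (n : ℂ)⁻¹ * (dftRoot n ^ l.1 / dftRoot n ^ k.1) ^ m.1 := by
    intro m
    have hstar : star (dftC n k m)
        = ((1 / Real.sqrt n : ℝ) : ℂ) * (dftRoot n ^ (k.1 * m.1))⁻¹ := by
      rw [dftC, star_mul', star_pow, conj_dftRoot, Complex.star_def, Complex.conj_ofReal, inv_pow]
    rw [conjTranspose_apply, hstar, dftC, mul_mul_mul_comm, hsq, div_pow, ← pow_mul, ← pow_mul,
      div_eq_mul_inv]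
  rw [Matrix.mul_apply, Finset.sum_congr rfl fun m _ => hterm m, ← Finset.mul_sum,
    Fin.sum_univ_eq_sum_range (fun m => (dftRoot n ^ l.1 / dftRoot n ^ k.1) ^ m)]
  by_cases hlk : l = k
  · subst hlk
    simp [h0, hn]
  · have hne : dftRoot n ^ l.1 / dftRoot n ^ k.1 ≠ 1 := by
      rw [Ne, div_eq_one_iff_eq (pow_ne_zero _ h0)]
      exact fun h => hlk (Fin.ext (hζ.pow_inj l.2 k.2 h))
    rw [geom_sum_eq hne, div_pow, ← pow_mul, ← pow_mul, mul_comm l.1, mul_comm k.1, pow_mul,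
      pow_mul, hζ.pow_eq_one]
    simp [hlk]

lemma dftC_add {n : ℕ} (l u t : Fin n) :
    dftC n l (u + t) = Real.sqrt n * (dftC n l u * dftC n l t) := by
  have hn : n ≠ 0 := by rintro rfl; exact l.elim0
  have hs : (Real.sqrt n : ℂ) ≠ 0 := by
    simpa using hn
  have hpow : dftRoot n ^ (l.1 * (u + t).1)
      = dftRoot n ^ (l.1 * u.1) * dftRoot n ^ (l.1 * t.1) := by
    have h1 : (dftRoot n ^ l.1) ^ n = 1 := by
      rw [← pow_mul, mul_comm, pow_mul, (dftRoot_isPrimitiveRoot hn).pow_eq_one, one_pow]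
    rw [← pow_add, ← mul_add, Fin.val_add, pow_mul, pow_mul, ← pow_eq_pow_mod _ h1]
  simp only [dftC, hpow]
  push_cast
  field_simp

/-- The embedding of `ℂ` in the quaternions sending `i` to a square root `ν` of `-1`. -/
abbrev embed (ν : Quaternion ℝ) (hν : ν * ν = -1) : ℂ →ₐ[ℝ] Quaternion ℝ := Complex.liftAux ν hν

lemma embed_ofReal (ν : Quaternion ℝ) (hν : ν * ν = -1) (x : ℝ) :
    embed ν hν (x : ℂ) = (x : Quaternion ℝ) :=
  (embed ν hν).commutes x

lemma star_embed {ν : Quaternion ℝ} (hν : ν * ν = -1) (hre : ν.re = 0) (z : ℂ) :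
    star (embed ν hν z) = embed ν hν (star z) := by
  ext <;> simp [Complex.liftAux_apply, Quaternion.algebraMap_def, hre]

lemma Fq_eq_map {ν : Quaternion ℝ} (hν : ν * ν = -1) (n : ℕ) :
    Fq ν n = (dftC n).map (embed ν hν) := by
  ext1 p q
  rw [Matrix.map_apply, dftC, map_mul, embed_ofReal, dftRoot_pow, Fq, Complex.liftAux_apply,
    Quaternion.coe_mul_eq_smul (Real.sin _)]
  simp only [neg_smul, ← sub_eq_add_neg, Nat.cast_mul]
  rfl

lemma Fq_mul_conjTranspose {ν : Quaternion ℝ} (hν : ν * ν = -1) (hre : ν.re = 0) (n : ℕ) :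
    Fq ν n * (Fq ν n)ᴴ = 1 := by
  rw [Fq_eq_map hν, ← Matrix.conjTranspose_map _ fun z => (star_embed hν hre z).symm,
    ← Matrix.map_mul, dftC_mul_conjTranspose, Matrix.map_one _ (map_zero _) (map_one _)]

lemma conjTranspose_mul_Fq {ν : Quaternion ℝ} (hν : ν * ν = -1) (hre : ν.re = 0) (n : ℕ) :
    (Fq ν n)ᴴ * Fq ν n = 1 := by
  rw [Fq_eq_map hν, ← Matrix.conjTranspose_map _ fun z => (star_embed hν hre z).symm,
    ← Matrix.map_mul, mul_eq_one_comm.mp (dftC_mul_conjTranspose n),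
    Matrix.map_one _ (map_zero _) (map_one _)]

lemma Fq_add {ν : Quaternion ℝ} (hν : ν * ν = -1) {n : ℕ} (l u t : Fin n) :
    Fq ν n l (u + t) = (Real.sqrt n : Quaternion ℝ) * (Fq ν n l u * Fq ν n l t) := by
  simp only [Fq_eq_map hν, Matrix.map_apply, dftC_add, map_mul, embed_ofReal]

/-- The DFT of a real circular convolution kernel. -/
lemma sum_Fq_mul_sub {ν : Quaternion ℝ} (hν : ν * ν = -1) {n : ℕ} (a : Fin n → ℝ)
    (l t : Fin n) :
    ∑ m, Fq ν n l m * (a (m - t) : Quaternion ℝ)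
      = (Real.sqrt n : Quaternion ℝ) * (∑ u, Fq ν n l u * (a u : Quaternion ℝ)) * Fq ν n l t := by
  have : NeZero n := ⟨by rintro rfl; exact l.elim0⟩
  rw [← Equiv.sum_comp (Equiv.addRight t), Finset.mul_sum, Finset.sum_mul]
  refine Finset.sum_congr rfl fun u _ => ?_
  simp only [Equiv.coe_addRight, add_sub_cancel_right, Fq_add hν, mul_assoc,
    Quaternion.coe_commutes (a u)]

/-- The DFT of a twisted circular convolution kernel along an imaginary unit `q`
intertwining `μ` and `ν`. -/
lemma sum_Fq_mul_twisted {μ ν q : Quaternion ℝ} (hν : ν * ν = -1) (hre : ν.re = 0)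
    (hq : μ * q = q * ν) {n : ℕ} (a : Fin n → ℝ) (l s : Fin n) :
    ∑ m, Fq μ n l m * (q * ∑ t, (a (m - t) : Quaternion ℝ) * Tm ν μ n t s)
      = (Real.sqrt n : Quaternion ℝ) * (∑ u, Fq μ n l u * ((a u : Quaternion ℝ) * q))
        * Fq μ n l s := by
  have hF : ∀ m, Fq μ n l m * q = q * Fq ν n l m := by
    intro m
    simp only [Fq, Quaternion.coe_mul_eq_smul, Quaternion.mul_coe_eq_smul, smul_mul_assoc,
      mul_smul_comm, sub_mul, mul_sub, hq]
  have hT : ∑ t, Fq ν n l t * Tm ν μ n t s = Fq μ n l s := by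
    rw [← Matrix.mul_apply, Tm, ← Matrix.mul_assoc, Fq_mul_conjTranspose hν hre, Matrix.one_mul]
  calc _ = q * ∑ t, (∑ m, Fq ν n l m * (a (m - t) : Quaternion ℝ)) * Tm ν μ n t s := by
        simp only [← mul_assoc, hF, Finset.mul_sum, Finset.sum_mul]
        exact Finset.sum_comm
    _ = q * ((Real.sqrt n : Quaternion ℝ) * (∑ u, Fq ν n l u * (a u : Quaternion ℝ))
          * Fq μ n l s) := by
        simp only [sum_Fq_mul_sub hν]
        simp only [mul_assoc, ← Finset.mul_sum, hT]
    _ = _ := by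
        rw [← mul_assoc, ← mul_assoc, ← Quaternion.coe_commutes, mul_assoc _ q, Finset.mul_sum]
        simp only [← mul_assoc, ← hF]
        simp only [mul_assoc, Quaternion.coe_commutes (a _)]

/-- The block matrix by which the gQt-product acts on unfolded tensors. -/
def gQtKernel {n₁ r n₃ : ℕ} (μ : Quaternion ℝ) (A : QTensor n₁ r n₃) (p : Fin n₁) (x : Fin r)
    (m s : Fin n₃) : Quaternion ℝ :=
  ((A p x (m - s)).re : Quaternion ℝ)
    + qi * ∑ t, ((A p x (m - t)).imI : Quaternion ℝ) * Tm (mui μ) μ n₃ t s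
    + qj * ∑ t, ((A p x (m - t)).imJ : Quaternion ℝ) * Tm (muj μ) μ n₃ t s
    + qk * ∑ t, ((A p x (m - t)).imK : Quaternion ℝ) * Tm (muk μ) μ n₃ t s

lemma mul_kronecker_one_apply {ι α β R : Type*} [Fintype β] [DecidableEq β] [Fintype ι] [Semiring R]
    (M : Matrix (ι × α) (ι × β) R) (T : Matrix ι ι R) (i : ι × α) (s : ι) (x : β) :
    (M * (T ⊗ₖ (1 : Matrix β β R))) i (s, x) = ∑ t, M i (t, x) * T t s := by
  simp [Matrix.mul_apply, Fintype.sum_prod_type, Matrix.one_apply]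

lemma gQt_apply {n₁ r n₂ n₃ : ℕ} (μ : Quaternion ℝ) (A : QTensor n₁ r n₃)
    (B : QTensor r n₂ n₃) (p : Fin n₁) (q : Fin n₂) (m : Fin n₃) :
    gQt μ A B p q m = ∑ s, ∑ x, gQtKernel μ A p x m s * B x q s := by
  simp only [gQt, fold3, Matrix.mul_apply (N := unfold3 B), Fintype.sum_prod_type,
    Matrix.add_apply, Matrix.smul_apply, mul_kronecker_one_apply]
  rfl

lemma UnitPure.mul_self {μ : Quaternion ℝ} (hμ : UnitPure μ) : μ * μ = -1 := by
  have h : star μ = -μ := by ext <;> simp [hμ.1]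
  have h2 := Quaternion.self_mul_star μ
  rw [h, Quaternion.normSq_eq_norm_mul_self, hμ.2] at h2
  simpa [neg_eq_iff_eq_neg] using h2

lemma unitPure_of_components {μ ν : Quaternion ℝ} (hμ : UnitPure μ) (hre : ν.re = 0)
    (hI : ν.imI ^ 2 = μ.imI ^ 2) (hJ : ν.imJ ^ 2 = μ.imJ ^ 2) (hK : ν.imK ^ 2 = μ.imK ^ 2) :
    UnitPure ν := by
  refine ⟨hre, ?_⟩
  have h : ‖ν‖ * ‖ν‖ = ‖μ‖ * ‖μ‖ := by
    rw [← Quaternion.normSq_eq_norm_mul_self, ← Quaternion.normSq_eq_norm_mul_self,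
      Quaternion.normSq_def', Quaternion.normSq_def', hre, hμ.1, hI, hJ, hK]
  rw [hμ.2] at h
  nlinarith [norm_nonneg ν]

lemma unitPure_mui {μ : Quaternion ℝ} (hμ : UnitPure μ) : UnitPure (mui μ) :=
  unitPure_of_components hμ rfl (by simp [mui]) (by simp [mui]) (by simp [mui])

lemma unitPure_muj {μ : Quaternion ℝ} (hμ : UnitPure μ) : UnitPure (muj μ) :=
  unitPure_of_components hμ rfl (by simp [muj]) (by simp [muj]) (by simp [muj])

lemma unitPure_muk {μ : Quaternion ℝ} (hμ : UnitPure μ) : UnitPure (muk μ) :=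
  unitPure_of_components hμ rfl (by simp [muk]) (by simp [muk]) (by simp [muk])

lemma mul_qi {μ : Quaternion ℝ} (hμ : UnitPure μ) : μ * qi = qi * mui μ := by
  ext <;> simp only [Quaternion.re_mul, Quaternion.imI_mul, Quaternion.imJ_mul, Quaternion.imK_mul] <;>
    simp [qi, mui, hμ.1]

lemma mul_qj {μ : Quaternion ℝ} (hμ : UnitPure μ) : μ * qj = qj * muj μ := by
  ext <;> simp only [Quaternion.re_mul, Quaternion.imI_mul, Quaternion.imJ_mul, Quaternion.imK_mul] <;>
    simp [qj, muj, hμ.1]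

lemma mul_qk {μ : Quaternion ℝ} (hμ : UnitPure μ) : μ * qk = qk * muk μ := by
  ext <;> simp only [Quaternion.re_mul, Quaternion.imI_mul, Quaternion.imJ_mul, Quaternion.imK_mul] <;>
    simp [qk, muk, hμ.1]

lemma eq_coe_add_units (x : Quaternion ℝ) :
    x = (x.re : Quaternion ℝ) + x.imI * qi + x.imJ * qj + x.imK * qk := by
  simp only [Quaternion.coe_mul_eq_smul]
  ext <;> simp only [Quaternion.re_add, Quaternion.imI_add, Quaternion.imJ_add, Quaternion.imK_add,
    Quaternion.re_smul, Quaternion.imI_smul, Quaternion.imJ_smul, Quaternion.imK_smul] <;>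
    simp [qi, qj, qk]

lemma sum_Fq_mul_gQtKernel {n₁ r n₃ : ℕ} {μ : Quaternion ℝ} (hμ : UnitPure μ)
    (A : QTensor n₁ r n₃) (p : Fin n₁) (x : Fin r) (l s : Fin n₃) :
    ∑ m, Fq μ n₃ l m * gQtKernel μ A p x m s = fftT μ A p x l * Fq μ n₃ l s := by
  have hA : fftT μ A p x l = (Real.sqrt n₃ : Quaternion ℝ)
      * ∑ m, Fq μ n₃ l m * (((A p x m).re : Quaternion ℝ) + (A p x m).imI * qi
        + (A p x m).imJ * qj + (A p x m).imK * qk) := by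
    simp only [← eq_coe_add_units]
    rfl
  have hi := unitPure_mui hμ
  have hj := unitPure_muj hμ
  have hk := unitPure_muk hμ
  simp only [hA, gQtKernel, mul_add, add_mul, Finset.sum_add_distrib,
    sum_Fq_mul_sub hμ.mul_self fun m => (A p x m).re,
    sum_Fq_mul_twisted hi.mul_self hi.1 (mul_qi hμ) fun m => (A p x m).imI,
    sum_Fq_mul_twisted hj.mul_self hj.1 (mul_qj hμ) fun m => (A p x m).imJ,
    sum_Fq_mul_twisted hk.mul_self hk.1 (mul_qk hμ) fun m => (A p x m).imK]

lemma fslice_fftT_gQt {n₁ r n₂ n₃ : ℕ} {μ : Quaternion ℝ} (hμ : UnitPure μ)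
    (A : QTensor n₁ r n₃) (B : QTensor r n₂ n₃) (l : Fin n₃) :
    fslice (fftT μ (gQt μ A B)) l = fslice (fftT μ A) l * fslice (fftT μ B) l := by
  ext1 p q
  have h : ∑ m, Fq μ n₃ l m * gQt μ A B p q m
      = ∑ x, fftT μ A p x l * ∑ s, Fq μ n₃ l s * B x q s := by
    calc _ = ∑ s, ∑ x, (∑ m, Fq μ n₃ l m * gQtKernel μ A p x m s) * B x q s := by
          simp only [gQt_apply, Finset.mul_sum, Finset.sum_mul, mul_assoc]
          rw [Finset.sum_comm]
          exact Finset.sum_congr rfl fun s _ => Finset.sum_comm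
      _ = _ := by
          simp only [sum_Fq_mul_gQtKernel hμ, Finset.mul_sum, mul_assoc]
          exact Finset.sum_comm
  rw [Matrix.mul_apply]
  change (Real.sqrt n₃ : Quaternion ℝ) * (∑ m, Fq μ n₃ l m * gQt μ A B p q m)
    = ∑ x, fftT μ A p x l * ((Real.sqrt n₃ : Quaternion ℝ) * ∑ s, Fq μ n₃ l s * B x q s)
  rw [h, Finset.mul_sum]
  exact Finset.sum_congr rfl fun x _ => by
    rw [← mul_assoc, Quaternion.coe_commutes, mul_assoc]

lemma fftT_injective {a b c : ℕ} {μ : Quaternion ℝ} (hμ : UnitPure μ) :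
    Function.Injective (fftT (a := a) (b := b) (c := c) μ) := by
  intro C D h
  ext1 p
  ext1 q
  have hvec : Fq μ c *ᵥ C p q = Fq μ c *ᵥ D p q := by
    ext1 l
    have hc : c ≠ 0 := by rintro rfl; exact l.elim0
    have hs : (Real.sqrt c : Quaternion ℝ) ≠ 0 := by
      rw [Ne, ← Quaternion.coe_zero, Quaternion.coe_inj]
      simpa using hc
    exact mul_left_cancel₀ hs (congrFun (congrFun (congrFun h p) q) l)
  simpa [Matrix.mulVec_mulVec, conjTranspose_mul_Fq hμ.mul_self hμ.1]
    using congrArg ((Fq μ c)ᴴ *ᵥ ·) hvec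

/-- the gQt-product corresponds to slicewise products of QDFT tensors. -/
theorem gQt_iff_fft_slice_products {n₁ r n₂ n₃ : ℕ} (μ : Quaternion ℝ) (hμ : UnitPure μ)
    (A : QTensor n₁ r n₃) (B : QTensor r n₂ n₃) (C : QTensor n₁ n₂ n₃) :
    C = gQt μ A B ↔
      ∀ l : Fin n₃, fslice (fftT μ C) l = fslice (fftT μ A) l * fslice (fftT μ B) l := by
  refine ⟨?_, fun h => ?_⟩
  · rintro rfl
    exact fslice_fftT_gQt hμ A B
  · refine fftT_injective hμ ?_
    ext1 p
    ext1 q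
    ext1 l
    exact congrFun (congrFun ((h l).trans (fslice_fftT_gQt hμ A B l).symm) p) q

end QTpaper
end
end

section
/- Let μ be a unit pure quaternion and A ∈ ℍ^{n₁×n₂×n₃}. Then for every l ∈ {1,…,n₃}, the l-th frontal slice of fft(A*) equals the conjugate transpose of the l-th frontal slice of fft(A); equivalently, diag(fft(A*)) = (diag(fft(A)))*. -/
noncomputable section
open Matrix Kronecker Filter Topology

namespace QTpaper

/-- The primitive root of unity `exp (2πi/n)` in terms of cosine and sine, raised to a power. -/
lemma exp_two_pi_div_pow (n k : ℕ) :
    Complex.exp (2 * Real.pi * Complex.I / n) ^ k =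
      Complex.mk (Real.cos (2 * Real.pi * k / n)) (Real.sin (2 * Real.pi * k / n)) := by
  rw [← Complex.exp_nat_mul,
    show (k : ℂ) * (2 * Real.pi * Complex.I / n)
      = ((2 * Real.pi * k / n : ℝ) : ℂ) * Complex.I by push_cast; ring,
    Complex.exp_mul_I, Complex.mk_eq_add_mul_I, Complex.ofReal_cos, Complex.ofReal_sin]

/-- Row orthogonality of the powers of `exp (2πi/n)`. -/
lemma sum_exp_pow_mul_conj {n : ℕ} (l p : Fin n) :
    ∑ m : Fin n, star (Complex.exp (2 * Real.pi * Complex.I / n) ^ (l.1 * m.1)) *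
      Complex.exp (2 * Real.pi * Complex.I / n) ^ (p.1 * m.1) = if l = p then (n : ℂ) else 0 := by
  have hn : n ≠ 0 := fun h => by subst h; exact l.elim0
  set ζ := Complex.exp (2 * Real.pi * Complex.I / n) with hζ
  have hprim : IsPrimitiveRoot ζ n := Complex.isPrimitiveRoot_exp n hn
  have hunit : star ζ * ζ = 1 := by
    have := Complex.conj_mul' ζ
    rw [hprim.norm'_eq_one hn] at this
    simpa using this
  have hterm : ∀ m : Fin n, star (ζ ^ (l.1 * m.1)) * ζ ^ (p.1 * m.1)
      = (star ζ ^ l.1 * ζ ^ p.1) ^ m.1 := fun m => by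
    rw [star_pow, mul_pow, pow_mul, pow_mul]
  simp_rw [hterm]
  rw [Fin.sum_univ_eq_sum_range (fun m => (star ζ ^ l.1 * ζ ^ p.1) ^ m) n]
  split_ifs with h
  · subst h
    simp only [← mul_pow, hunit, one_pow, Finset.sum_const, Finset.card_range, nsmul_eq_mul,
      mul_one]
  · have hpow : (star ζ ^ l.1 * ζ ^ p.1) ^ n = 1 := by
      rw [mul_pow, ← pow_mul, ← pow_mul, mul_comm l.1, mul_comm p.1, pow_mul, pow_mul,
        ← star_pow, hprim.pow_eq_one]
      simp
    have hne : star ζ ^ l.1 * ζ ^ p.1 ≠ 1 := fun h1 => h <| by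
      refine Fin.ext (hprim.pow_inj l.2 p.2 ?_)
      calc ζ ^ l.1 = ζ ^ l.1 * (star ζ ^ l.1 * ζ ^ p.1) := by rw [h1, mul_one]
        _ = (star ζ * ζ) ^ l.1 * ζ ^ p.1 := by rw [mul_pow]; ring
        _ = ζ ^ p.1 := by rw [hunit, one_pow, one_mul]
    have := mul_neg_geom_sum (star ζ ^ l.1 * ζ ^ p.1) n
    rw [hpow, sub_self] at this
    exact (mul_eq_zero.mp this).resolve_left (sub_ne_zero.mpr hne.symm)

/-- The QDFT matrix has orthonormal rows. -/
lemma Fq_mul_conjTranspose_s8 {μ : Quaternion ℝ} (hμ : UnitPure μ) (n : ℕ) :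
    Fq μ n * (Fq μ n)ᴴ = 1 := by
  let φ : ℂ →ₐ[ℝ] Quaternion ℝ := Complex.lift ⟨μ, hμ.mul_self⟩
  have hφ : ∀ x y : ℝ, φ ⟨x, y⟩ = (x : Quaternion ℝ) + (y : Quaternion ℝ) * μ := fun x y => by
    simp only [φ, Complex.lift_apply, Complex.liftAux_apply]
    rw [← Quaternion.coe_mul_eq_smul]
    rfl
  have hF : ∀ l m : Fin n, Fq μ n l m = ((1 / Real.sqrt n : ℝ) : Quaternion ℝ) *
      φ (star (Complex.exp (2 * Real.pi * Complex.I / n) ^ (l.1 * m.1))) := fun l m => by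
    rw [exp_two_pi_div_pow, show ∀ x y : ℝ, star (Complex.mk x y) = ⟨x, -y⟩ from fun _ _ => rfl, hφ]
    simp [Fq, sub_eq_add_neg]
  have hF' : ∀ l m : Fin n, star (Fq μ n l m) = ((1 / Real.sqrt n : ℝ) : Quaternion ℝ) *
      φ (Complex.exp (2 * Real.pi * Complex.I / n) ^ (l.1 * m.1)) := fun l m => by
    rw [exp_two_pi_div_pow, hφ]
    simp only [Fq, Nat.cast_mul]
    generalize 1 / Real.sqrt n = r
    ext <;> simp [hμ.1] <;> ring
  ext1 l p
  have hn : (n : ℝ) ≠ 0 := by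
    have : n ≠ 0 := fun h => by subst h; exact l.elim0
    exact_mod_cast this
  have hterm : ∀ m : Fin n, Fq μ n l m * star (Fq μ n p m) = ((1 / n : ℝ) : Quaternion ℝ) *
      φ (star (Complex.exp (2 * Real.pi * Complex.I / n) ^ (l.1 * m.1)) *
        Complex.exp (2 * Real.pi * Complex.I / n) ^ (p.1 * m.1)) := fun m => by
    rw [hF, hF', map_mul, mul_assoc, ← mul_assoc (φ _), ← Quaternion.coe_commutes, ← mul_assoc,
      ← mul_assoc, ← Quaternion.coe_mul, div_mul_div_comm, Real.mul_self_sqrt n.cast_nonneg,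
      one_mul, mul_assoc]
  simp only [Matrix.mul_apply, Matrix.conjTranspose_apply, hterm]
  rw [← Finset.mul_sum, ← map_sum, sum_exp_pow_mul_conj, Matrix.one_apply]
  split_ifs with h
  · rw [map_natCast, ← Quaternion.coe_natCast, ← Quaternion.coe_mul, one_div_mul_cancel hn,
      Quaternion.coe_one]
  · simp

/-- Multiplying by the QDFT matrix turns `T*` into the QDFT matrix of the other axis. -/
lemma Fq_mul_conjTranspose_Tm {μ : Quaternion ℝ} (hμ : UnitPure μ) (ν : Quaternion ℝ) (n : ℕ) :
    Fq μ n * (Tm ν μ n)ᴴ = Fq ν n := by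
  rw [Tm, Matrix.conjTranspose_mul, Matrix.conjTranspose_conjTranspose, ← Matrix.mul_assoc,
    Fq_mul_conjTranspose_s8 hμ, Matrix.one_mul]

lemma revIdx_involutive {c : ℕ} : Function.Involutive (revIdx (c := c)) := fun l => by
  have := l.2
  unfold revIdx
  apply Fin.ext
  split_ifs <;> simp_all <;> omega

/-- Reversing the column index conjugates the entries of the QDFT matrix. -/
lemma Fq_revIdx {ν : Quaternion ℝ} (hν : ν.re = 0) {n : ℕ} (l m : Fin n) :
    Fq ν n l (revIdx m) = star (Fq ν n l m) := by
  have hn : (n : ℝ) ≠ 0 := by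
    have : n ≠ 0 := fun h => by subst h; exact l.elim0
    exact_mod_cast this
  by_cases hm : m.1 = 0
  · have : revIdx m = m := by simp [revIdx, hm]
    rw [this]
    ext <;> simp [Fq, hm]
  · have hr : (((revIdx m).1 : ℕ) : ℝ) = n - m.1 := by
      simp only [revIdx, hm, dif_neg, not_false_eq_true]
      exact Nat.cast_sub m.2.le
    have hang : 2 * Real.pi * (l.1 * ((revIdx m).1 : ℕ)) / n
        = l.1 * (2 * Real.pi) - 2 * Real.pi * (l.1 * m.1) / n := by
      rw [hr]; field_simp
    simp only [Fq, hang, Real.cos_nat_mul_two_pi_sub, Real.sin_nat_mul_two_pi_sub]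
    generalize 1 / Real.sqrt n = r
    ext <;> simp [hν] <;> ring

/-- Entries of `(M ⊗ I) * unfold B`. -/
lemma kronecker_one_mul_unfold3 {a b c : ℕ} (M : Matrix (Fin c) (Fin c) (Quaternion ℝ))
    (B : QTensor a b c) (m : Fin c) (p : Fin a) (q : Fin b) :
    ((M ⊗ₖ (1 : Matrix (Fin a) (Fin a) (Quaternion ℝ))) * unfold3 B) (m, p) q
      = (M *ᵥ B p q) m := by
  simp [Matrix.mul_apply, Fintype.sum_prod_type, Matrix.kroneckerMap_apply, unfold3,
    Matrix.mulVec, dotProduct, Matrix.one_apply]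

/-- A weighted row sum of the QDFT matrix against a reversed vector. -/
lemma sum_Fq_mul_revIdx {ν : Quaternion ℝ} (hν : ν.re = 0) {n : ℕ} (l : Fin n)
    (b : Fin n → Quaternion ℝ) :
    ∑ m, Fq ν n l m * b (revIdx m) = ∑ m, star (Fq ν n l m) * b m := by
  rw [← Equiv.sum_comp (revIdx_involutive (c := n)).toPerm (fun m => Fq ν n l m * b (revIdx m))]
  exact Finset.sum_congr rfl fun m _ => by
    simp only [Function.Involutive.coe_toPerm]
    rw [revIdx_involutive m, Fq_revIdx hν]

lemma sum_Fq_mul_Tm_mulVec {μ : Quaternion ℝ} (hμ : UnitPure μ) {ν : Quaternion ℝ} (hν : ν.re = 0)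
    {n : ℕ} (l : Fin n) (b : Fin n → Quaternion ℝ) (x : Quaternion ℝ) :
    ∑ m, Fq μ n l m * (((Tm ν μ n)ᴴ *ᵥ fun m' => b (revIdx m')) m * x)
      = ∑ m, star (Fq ν n l m) * b m * x := by
  simp_rw [← mul_assoc, ← Finset.sum_mul]
  rw [← sum_Fq_mul_revIdx hν l b]
  congr 1
  have h := congrFun (Matrix.mulVec_mulVec (fun m' => b (revIdx m')) (Fq μ n) (Tm ν μ n)ᴴ) l
  rwa [Fq_mul_conjTranspose_Tm hμ] at h

/-- The entrywise identity behind the compatibility of the QDFT with conjugate transposes. -/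
lemma star_Fq_mul_components {μ : Quaternion ℝ} (hμ : μ.re = 0) {n : ℕ} (l m : Fin n)
    (x : Quaternion ℝ) :
    star (Fq μ n l m) * (x.re : Quaternion ℝ)
      - star (Fq (mui μ) n l m) * (x.imI : Quaternion ℝ) * qi
      - star (Fq (muj μ) n l m) * (x.imJ : Quaternion ℝ) * qj
      - star (Fq (muk μ) n l m) * (x.imK : Quaternion ℝ) * qk = star (Fq μ n l m * x) := by
  simp only [Fq]
  generalize Real.cos _ = u
  generalize Real.sin _ = v
  generalize 1 / Real.sqrt n = r
  have hqi : qi.re = 0 ∧ qi.imI = 1 ∧ qi.imJ = 0 ∧ qi.imK = 0 := ⟨rfl, rfl, rfl, rfl⟩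
  have hqj : qj.re = 0 ∧ qj.imI = 0 ∧ qj.imJ = 1 ∧ qj.imK = 0 := ⟨rfl, rfl, rfl, rfl⟩
  have hqk : qk.re = 0 ∧ qk.imI = 0 ∧ qk.imJ = 0 ∧ qk.imK = 1 := ⟨rfl, rfl, rfl, rfl⟩
  have hi : (mui μ).re = 0 ∧ (mui μ).imI = μ.imI ∧ (mui μ).imJ = -μ.imJ ∧
      (mui μ).imK = -μ.imK := ⟨rfl, rfl, rfl, rfl⟩
  have hj : (muj μ).re = 0 ∧ (muj μ).imI = -μ.imI ∧ (muj μ).imJ = μ.imJ ∧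
      (muj μ).imK = -μ.imK := ⟨rfl, rfl, rfl, rfl⟩
  have hk : (muk μ).re = 0 ∧ (muk μ).imI = -μ.imI ∧ (muk μ).imJ = -μ.imJ ∧
      (muk μ).imK = μ.imK := ⟨rfl, rfl, rfl, rfl⟩
  ext <;> simp [hqi, hqj, hqk, hi, hj, hk, hμ] <;> ring

/-- the QDFT of the tensor conjugate transpose has slicewise
conjugate-transposed frontal slices. -/
theorem fft_conjT_slices {n₁ n₂ n₃ : ℕ} (μ : Quaternion ℝ) (hμ : UnitPure μ)
    (A : QTensor n₁ n₂ n₃) :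
    ∀ l : Fin n₃, fslice (fftT μ (conjT μ A)) l = (fslice (fftT μ A) l)ᴴ := by
  intro l
  ext1 q p
  simp only [fslice, fftT, Matrix.conjTranspose_apply, conjT, fold3, rmulM, Matrix.sub_apply,
    kronecker_one_mul_unfold3, mul_sub, Finset.sum_sub_distrib]
  rw [star_mul, Quaternion.star_coe, ← Quaternion.coe_commutes, ← mul_sub, ← mul_sub, ← mul_sub]
  congr 1
  have hE := sum_Fq_mul_revIdx hμ.1 l (compE A p q)
  have hI := sum_Fq_mul_Tm_mulVec hμ (ν := mui μ) rfl l (compI A p q) qi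
  have hJ := sum_Fq_mul_Tm_mulVec hμ (ν := muj μ) rfl l (compJ A p q) qj
  have hK := sum_Fq_mul_Tm_mulVec hμ (ν := muk μ) rfl l (compK A p q) qk
  refine (congrArg₂ (· - ·) (congrArg₂ (· - ·) (congrArg₂ (· - ·) hE hI) hJ) hK).trans ?_
  rw [star_sum, ← Finset.sum_sub_distrib, ← Finset.sum_sub_distrib, ← Finset.sum_sub_distrib]
  exact Finset.sum_congr rfl fun m _ => star_Fq_mul_components hμ.1 l m (A p q m)

end QTpaper
end
end
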